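/- Let H: ℝ^d → ℝ^d be continuously differentiable with I_d + ∇H(x) invertible and |(I_d + ∇H(x))^{−1}| ≤ N_κ for all x, and let H̃(x) = x + H(x). Suppose |H|₀ ≤ L₄ and, for some β > 0, |∇H|_{(β∨1)−1} ≤ L₅ (with |∇H|₀ meant when β ≤ 1). Let μ ∈ (0,1] and θ ≥ 0, and let φ: ℝ^d → ℝ be such that r₁^{−θ}φ ∈ C^{β+μ}(ℝ^d), i.e. |r₁^{−θ}φ|_{β+μ} < ∞. Then there is a constant N = N(d, β, μ, N_κ, L₄, L₅, θ) such that |r₁^{−θ}(φ∘H̃^{−1} − φ)|_β ≤ N |r₁^{−θ}φ|_β (|H|₀ + |∇H|_{(β∨1)−1}) + N·1_{(0,1]}({β}⁺+μ) Σ_{|γ|=[β]⁻} [∂^γ(r₁^{−θ}φ)]_{{β}⁺+μ} L₄^μ + N·1_{(1,2]}({β}⁺+μ) Σ_{|γ|=[β]⁻} ( [∇∂^γ(r₁^{−θ}φ)]_{{β}⁺+μ−1} L₄^μ + |∇∂^γ(r₁^{−θ}φ)|₀ |∇H|₀ ). -/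

import Mathlib

open scoped ENNReal RealInnerProductSpace

noncomputable section

/-- `ℝ^d` with the Euclidean norm. -/
abbrev Euc (d : ℕ) : Type := EuclideanSpace ℝ (Fin d)

/-- The weight `r₁(x) = (1 + |x|²)^{1/2}`. -/
def r1 {d : ℕ} (x : Euc d) : ℝ := Real.sqrt (1 + ‖x‖ ^ 2)

/-- Sup-norm `|f|₀ = sup_x ‖f x‖`, valued in `[0,∞]`. -/
def nrm0 {d : ℕ} {V : Type*} [NormedAddCommGroup V] (f : Euc d → V) : ℝ≥0∞ :=
  ⨆ x, (‖f x‖₊ : ℝ≥0∞)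

/-- Hölder seminorm `[f]_β = sup_{x ≠ y} ‖f x - f y‖ / ‖x - y‖^β`, valued in `[0,∞]`. -/
def hsemi {d : ℕ} {V : Type*} [NormedAddCommGroup V] (β : ℝ) (f : Euc d → V) : ℝ≥0∞ :=
  ⨆ (x : Euc d) (y : Euc d) (_ : x ≠ y),
    (‖f x - f y‖₊ : ℝ≥0∞) / ENNReal.ofReal (‖x - y‖ ^ β)

/-- Partial derivative in the `i`-th coordinate direction. -/
def pder {d : ℕ} {V : Type*} [NormedAddCommGroup V] [NormedSpace ℝ V]
    (i : Fin d) (f : Euc d → V) : Euc d → V :=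
  fun x => fderiv ℝ f x (EuclideanSpace.single i 1)

/-- Iterated partial derivative in the `i`-th coordinate direction. -/
def pderPow {d : ℕ} {V : Type*} [NormedAddCommGroup V] [NormedSpace ℝ V]
    (i : Fin d) : ℕ → (Euc d → V) → Euc d → V
  | 0, f => f
  | n + 1, f => pder i (pderPow i n f)

/-- Multi-index partial derivative `∂^γ f = ∂_1^{γ 1} ⋯ ∂_d^{γ d} f`. -/
def mder {d : ℕ} {V : Type*} [NormedAddCommGroup V] [NormedSpace ℝ V]
    (γ : Fin d → ℕ) (f : Euc d → V) : Euc d → V :=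
  (List.finRange d).foldr (fun i g => pderPow i (γ i) g) f

/-- `[β]⁻`: for `β > 0`, the nonnegative integer with `β = [β]⁻ + {β}⁺`, `{β}⁺ ∈ (0,1]`. -/
def ifl (β : ℝ) : ℕ := ⌈β⌉₊ - 1

/-- `{β}⁺`: the fractional part in `(0,1]` of `β > 0`. -/
def frc (β : ℝ) : ℝ := β - (ifl β : ℝ)

/-- Hölder norm `|f|_β = Σ_{|γ| ≤ [β]⁻} |∂^γ f|₀ + Σ_{|γ| = [β]⁻} [∂^γ f]_{{β}⁺}`,
valued in `[0,∞]`. -/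
def holNorm {d : ℕ} {V : Type*} [NormedAddCommGroup V] [NormedSpace ℝ V]
    (β : ℝ) (f : Euc d → V) : ℝ≥0∞ :=
  (∑' γ : {γ : Fin d → ℕ // (∑ i, γ i) ≤ ifl β}, nrm0 (mder γ.1 f))
    + ∑' γ : {γ : Fin d → ℕ // (∑ i, γ i) = ifl β}, hsemi (frc β) (mder γ.1 f)

/-- `H̃(x) = x + H(x)`. -/
def tilde {d : ℕ} (H : Euc d → Euc d) : Euc d → Euc d := fun x => x + H x

/-- `H̃⁻¹`, the inverse map of `H̃`. -/
def tildeInv {d : ℕ} (H : Euc d → Euc d) : Euc d → Euc d := Function.invFun (tilde H)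

/-- `F(x) = H̃⁻¹(x) - x`, so that `H̃⁻¹(x) = x + F(x)`. -/
def Fof {d : ℕ} (H : Euc d → Euc d) : Euc d → Euc d := fun x => tildeInv H x - x

section HolderBounded

variable {E V W X : Type} [NormedAddCommGroup E] [NormedSpace ℝ E]
  [NormedAddCommGroup V] [NormedSpace ℝ V] [NormedAddCommGroup W] [NormedSpace ℝ W]
  [NormedAddCommGroup X] [NormedSpace ℝ X]

/-- `HolderBdd α A m f`: the (total) derivatives of `f` up to order `m` are bounded by `A`, and the
one of order `m` is `α`-Hölder with constant `A`. -/
def HolderBdd (α A : ℝ) : ℕ → ∀ {V : Type} [NormedAddCommGroup V] [NormedSpace ℝ V],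
    (E → V) → Prop
  | 0, _, _, _, f => (∀ x, ‖f x‖ ≤ A) ∧ ∀ x y, ‖f x - f y‖ ≤ A * ‖x - y‖ ^ α
  | m + 1, _, _, _, f => (∀ x, ‖f x‖ ≤ A) ∧ Differentiable ℝ f ∧ HolderBdd α A m (fderiv ℝ f)

variable {α A A' : ℝ} {m : ℕ} {f : E → V} {g : E → W}

/-- A differentiable function with derivative bounded by `K` is `K`-Lipschitz. -/
lemma norm_sub_le_of_fderiv_le {K : ℝ} (hf : Differentiable ℝ f) (hK : ∀ x, ‖fderiv ℝ f x‖ ≤ K)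
    (x y : E) : ‖f x - f y‖ ≤ K * ‖x - y‖ :=
  convex_univ.norm_image_sub_le_of_norm_fderiv_le (fun z _ => hf z) (fun z _ => hK z)
    (Set.mem_univ y) (Set.mem_univ x)

/-- A bounded `σ`-Hölder function is `α`-Hölder for `α ≤ σ`. -/
lemma norm_sub_le_rpow_of_le {E V : Type*} [NormedAddCommGroup E] [NormedAddCommGroup V]
    {f : E → V} {α σ A B : ℝ} (hα : 0 < α) (hασ : α ≤ σ) (hf : ∀ x, ‖f x‖ ≤ A)
    (hσ : ∀ x y, ‖f x - f y‖ ≤ B * ‖x - y‖ ^ σ) (hB : B ≤ 2 * A) (x y : E) :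
    ‖f x - f y‖ ≤ 2 * A * ‖x - y‖ ^ α := by
  have hA : 0 ≤ A := (norm_nonneg _).trans (hf x)
  rcases le_total ‖x - y‖ 1 with h | h
  · rcases eq_or_ne x y with rfl | hxy
    · simp [Real.zero_rpow hα.ne']
    have hpos : 0 < ‖x - y‖ := norm_pos_iff.2 (sub_ne_zero.2 hxy)
    calc ‖f x - f y‖ ≤ B * ‖x - y‖ ^ σ := hσ x y
      _ ≤ 2 * A * ‖x - y‖ ^ σ := by gcongr
      _ ≤ 2 * A * ‖x - y‖ ^ α := by
        gcongr 2 * A * ?_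
        exact Real.rpow_le_rpow_of_exponent_ge hpos h hασ
  · calc ‖f x - f y‖ ≤ ‖f x‖ + ‖f y‖ := norm_sub_le _ _
      _ ≤ 2 * A * 1 := by linarith [hf x, hf y]
      _ ≤ 2 * A * ‖x - y‖ ^ α := by
        gcongr
        exact Real.one_le_rpow h hα.le

namespace HolderBdd

lemma norm_le (hf : HolderBdd α A m f) (x : E) : ‖f x‖ ≤ A := by
  cases m <;> exact hf.1 x

lemma nonneg (hf : HolderBdd α A m f) : 0 ≤ A :=
  (norm_nonneg _).trans (hf.norm_le 0)

lemma mono (hf : HolderBdd α A m f) (h : A ≤ A') : HolderBdd α A' m f := by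
  induction m generalizing V with
  | zero =>
    exact ⟨fun x => (hf.1 x).trans h, fun x y => (hf.2 x y).trans (by gcongr)⟩
  | succ m ih => exact ⟨fun x => (hf.1 x).trans h, hf.2.1, ih hf.2.2⟩

lemma add {f g : E → V} (hf : HolderBdd α A m f) (hg : HolderBdd α A' m g) :
    HolderBdd α (A + A') m (fun x => f x + g x) := by
  induction m generalizing V with
  | zero =>
    refine ⟨fun x => (norm_add_le _ _).trans (add_le_add (hf.1 x) (hg.1 x)), fun x y => ?_⟩
    calc ‖f x + g x - (f y + g y)‖ = ‖(f x - f y) + (g x - g y)‖ := by congr 1; abel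
      _ ≤ A * ‖x - y‖ ^ α + A' * ‖x - y‖ ^ α :=
        (norm_add_le _ _).trans (add_le_add (hf.2 x y) (hg.2 x y))
      _ = _ := by ring
  | succ m ih =>
    refine ⟨fun x => (norm_add_le _ _).trans (add_le_add (hf.1 x) (hg.1 x)),
      hf.2.1.add hg.2.1, ?_⟩
    have : fderiv ℝ (fun x => f x + g x) = fun x => fderiv ℝ f x + fderiv ℝ g x :=
      funext fun x => fderiv_fun_add (hf.2.1 x) (hg.2.1 x)
    rw [this]
    exact ih hf.2.2 hg.2.2

lemma zero : HolderBdd α 0 m (fun _ : E => (0 : V)) := by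
  induction m generalizing V with
  | zero => exact ⟨by simp, by simp⟩
  | succ m ih =>
    refine ⟨by simp, differentiable_const 0, ?_⟩
    have : fderiv ℝ (fun _ : E => (0 : V)) = fun _ => 0 := funext fun x => by simp
    rw [this]
    exact ih

lemma sum {ι : Type*} (s : Finset ι) {f : ι → E → V} (hf : ∀ i ∈ s, HolderBdd α A m (f i)) :
    HolderBdd α (s.card * A) m (fun x => ∑ i ∈ s, f i x) := by
  classical
  induction s using Finset.induction_on with
  | empty => simpa using zero
  | insert i s hi ih =>
    have h := (hf i (Finset.mem_insert_self i s)).add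
      (ih fun j hj => hf j (Finset.mem_insert_of_mem hj))
    simp only [Finset.sum_insert hi, Finset.card_insert_of_notMem hi]
    exact h.mono (by push_cast; linarith)

lemma clm (hf : HolderBdd α A m f) (L : V →L[ℝ] W) {c : ℝ} (hL : ‖L‖ ≤ c) :
    HolderBdd α (c * A) m (fun x => L (f x)) := by
  have hA := hf.nonneg
  have hsup : ∀ x, ‖L (f x)‖ ≤ c * A := fun x =>
    (L.le_of_opNorm_le hL _).trans
      (mul_le_mul_of_nonneg_left (hf.norm_le x) ((norm_nonneg _).trans hL))
  induction m generalizing V W with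
  | zero =>
    refine ⟨hsup, fun x y => ?_⟩
    rw [← map_sub, mul_assoc]
    exact (L.le_of_opNorm_le hL _).trans
      (mul_le_mul_of_nonneg_left (hf.2 x y) ((norm_nonneg _).trans hL))
  | succ m ih =>
    refine ⟨hsup, L.differentiable.comp hf.2.1, ?_⟩
    have : fderiv ℝ (fun x => L (f x)) =
        fun x => ContinuousLinearMap.compL ℝ E V W L (fderiv ℝ f x) :=
      funext fun x => (L.hasFDerivAt.comp x (hf.2.1 x).hasFDerivAt).fderiv
    rw [this]
    have hc : ‖ContinuousLinearMap.compL ℝ E V W L‖ ≤ c :=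
      (ContinuousLinearMap.le_of_opNorm_le _ (ContinuousLinearMap.norm_compL_le ℝ E V W) L).trans
        (by simpa using hL)
    refine ih hf.2.2 _ hc fun x => ?_
    exact (ContinuousLinearMap.le_of_opNorm_le _ hc _).trans
      (mul_le_mul_of_nonneg_left (hf.2.2.norm_le x) ((norm_nonneg _).trans hL))

lemma neg (hf : HolderBdd α A m f) : HolderBdd α A m (fun x => -f x) := by
  simpa using hf.clm (-ContinuousLinearMap.id ℝ V) (c := 1)
    (by rw [norm_neg]; exact ContinuousLinearMap.norm_id_le)

lemma const_smul (hf : HolderBdd α A m f) {c : ℝ} (hc : 0 ≤ c) :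
    HolderBdd α (c * A) m (fun x => c • f x) := by
  refine hf.clm (c • ContinuousLinearMap.id ℝ V) ?_
  rw [norm_smul, Real.norm_of_nonneg hc]
  exact mul_le_of_le_one_right hc ContinuousLinearMap.norm_id_le

lemma const (v : V) : HolderBdd α ‖v‖ m (fun _ : E => v) := by
  cases m with
  | zero => exact ⟨fun _ => le_rfl, fun x y => by simp; positivity⟩
  | succ m =>
    refine ⟨fun _ => le_rfl, differentiable_const v, ?_⟩
    have : fderiv ℝ (fun _ : E => v) = fun _ => 0 := funext fun x => by simp
    rw [this]
    exact zero.mono (norm_nonneg v)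

/-- Lowering the Hölder exponent. -/
lemma exponent_le {σ : ℝ} (hf : HolderBdd σ A m f) (hα : 0 < α) (hασ : α ≤ σ) :
    HolderBdd α (2 * A) m f := by
  have hA := hf.nonneg
  induction m generalizing V with
  | zero =>
    exact ⟨fun x => (hf.1 x).trans (by linarith),
      norm_sub_le_rpow_of_le hα hασ hf.1 hf.2 (by linarith)⟩
  | succ m ih => exact ⟨fun x => (hf.1 x).trans (by linarith), hf.2.1, ih hf.2.2⟩

/-- Functions with bounded derivative are bounded Hölder functions. -/
lemma of_fderiv_le (hα : 0 < α) (hα1 : α ≤ 1) (hf : ∀ x, ‖f x‖ ≤ A) (hd : Differentiable ℝ f)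
    (hf' : ∀ x, ‖fderiv ℝ f x‖ ≤ A) : HolderBdd α (2 * A) 0 f := by
  have hA : 0 ≤ A := (norm_nonneg _).trans (hf 0)
  refine exponent_le (σ := 1) ⟨hf, fun x y => ?_⟩ hα hα1
  simpa using norm_sub_le_of_fderiv_le hd hf' x y

/-- Lowering the order of differentiability. -/
lemma order_pred {σ : ℝ} (hf : HolderBdd σ A (m + 1) f) (hα : 0 < α) (hα1 : α ≤ 1) :
    HolderBdd α (2 * A) m f := by
  have hA := hf.nonneg
  induction m generalizing V with
  | zero => exact of_fderiv_le hα hα1 hf.1 hf.2.1 hf.2.2.norm_le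
  | succ m ih => exact ⟨fun x => (hf.1 x).trans (by linarith), hf.2.1, ih hf.2.2⟩

lemma order_le {n : ℕ} (hα : 0 < α) (hα1 : α ≤ 1) (hf : HolderBdd α A n f) (hmn : m ≤ n) :
    HolderBdd α (2 ^ (n - m) * A) m f := by
  induction n, hmn using Nat.le_induction generalizing A with
  | base => simpa using hf
  | succ n hmn ih =>
    refine (ih (hf.order_pred hα hα1)).mono (le_of_eq ?_)
    rw [Nat.succ_sub hmn, pow_succ]
    ring

/-- Bilinear products of Hölder functions. -/
lemma bilin (hα : 0 < α) (hα1 : α ≤ 1) (hf : HolderBdd α A m f) (hg : HolderBdd α A' m g)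
    (B : V →L[ℝ] W →L[ℝ] X) {b : ℝ} (hB : ‖B‖ ≤ b) :
    HolderBdd α (2 * 4 ^ m * b * A * A') m (fun x => B (f x) (g x)) := by
  have hb : 0 ≤ b := (norm_nonneg B).trans hB
  induction m generalizing V W X A A' with
  | zero =>
    have hA := hf.nonneg
    have hA' := hg.nonneg
    have hle : ∀ (v : V) (w : W), ‖B v w‖ ≤ b * ‖v‖ * ‖w‖ := fun v w =>
      (B.le_opNorm₂ v w).trans (by gcongr)
    refine ⟨fun x => ?_, fun x y => ?_⟩
    · calc ‖B (f x) (g x)‖ ≤ b * ‖f x‖ * ‖g x‖ := hle _ _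
        _ ≤ b * A * A' := by gcongr; exacts [hf.norm_le x, hg.norm_le x]
        _ ≤ 2 * 4 ^ 0 * b * A * A' := by
          have : 0 ≤ b * A * A' := by positivity
          linarith
    calc ‖B (f x) (g x) - B (f y) (g y)‖ = ‖B (f x - f y) (g x) + B (f y) (g x - g y)‖ := by
          congr 1; simp
      _ ≤ b * ‖f x - f y‖ * ‖g x‖ + b * ‖f y‖ * ‖g x - g y‖ :=
        (norm_add_le _ _).trans (add_le_add (hle _ _) (hle _ _))
      _ ≤ b * (A * ‖x - y‖ ^ α) * A' + b * A * (A' * ‖x - y‖ ^ α) := by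
        gcongr
        exacts [hf.2 x y, hg.1 x, hf.1 y, hg.2 x y]
      _ = _ := by ring
  | succ m ih =>
    have hA := hf.nonneg
    have hA' := hg.nonneg
    have hd := fun x => B.hasFDerivAt_of_bilinear (hf.2.1 x).hasFDerivAt (hg.2.1 x).hasFDerivAt
    refine ⟨fun x => ?_, fun x => (hd x).differentiableAt, ?_⟩
    · have h1 : (1 : ℝ) ≤ 2 * 4 ^ (m + 1) := by
        linarith [one_le_pow₀ (n := m + 1) (by norm_num : (1 : ℝ) ≤ 4)]
      calc ‖B (f x) (g x)‖ ≤ b * ‖f x‖ * ‖g x‖ := (B.le_opNorm₂ _ _).trans (by gcongr)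
        _ ≤ b * A * A' := by gcongr; exacts [hf.norm_le x, hg.norm_le x]
        _ ≤ (2 * 4 ^ (m + 1)) * (b * A * A') := le_mul_of_one_le_left (by positivity) h1
        _ = _ := by ring
    rw [show fderiv ℝ (fun x => B (f x) (g x)) = fun x =>
      B.precompR E (f x) (fderiv ℝ g x) + B.precompL E (fderiv ℝ f x) (g x) from
      funext fun x => (hd x).fderiv]
    refine ((ih (hf.order_pred hα hα1) hg.2.2 (B.precompR E)
      ((ContinuousLinearMap.norm_precompR_le _ B).trans hB)).add
      (ih hf.2.2 (hg.order_pred hα hα1) (B.precompL E)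
      ((ContinuousLinearMap.norm_precompL_le _ B).trans hB))).mono (le_of_eq ?_)
    ring

end HolderBdd

end HolderBounded

section NearIdentity

variable {E : Type} [NormedAddCommGroup E] [NormedSpace ℝ E] {α : ℝ}

/-- Composition of a Hölder function with a map whose derivative is bounded and Hölder. -/
lemma HolderBdd.comp (hα : 0 < α) (hα1 : α ≤ 1) (m : ℕ) {K : ℝ} (hK : 1 ≤ K) :
    ∃ C : ℝ, 1 ≤ C ∧ ∀ {V : Type} [NormedAddCommGroup V] [NormedSpace ℝ V] {f : E → V}
      {G : E → E} {A : ℝ}, HolderBdd α A m f → Differentiable ℝ G →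
      (∀ x, ‖fderiv ℝ G x‖ ≤ K) → (∀ j < m, HolderBdd α K j (fderiv ℝ G)) →
      HolderBdd α (C * A) m (fun x => f (G x)) := by
  induction m with
  | zero =>
    refine ⟨K, hK, fun {V _ _ f G A} hf hG hGK _ => ?_⟩
    have hA := hf.nonneg
    refine ⟨fun x => (hf.1 _).trans (le_mul_of_one_le_left hA hK), fun x y => ?_⟩
    calc ‖f (G x) - f (G y)‖ ≤ A * ‖G x - G y‖ ^ α := hf.2 _ _
      _ ≤ A * (K * ‖x - y‖) ^ α := by
        gcongr
        exact norm_sub_le_of_fderiv_le hG hGK x y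
      _ = A * (K ^ α * ‖x - y‖ ^ α) := by rw [Real.mul_rpow (by linarith) (norm_nonneg _)]
      _ ≤ A * (K * ‖x - y‖ ^ α) := by
        gcongr
        simpa using Real.rpow_le_rpow_of_exponent_le hK hα1
      _ = _ := by ring
  | succ m ih =>
    obtain ⟨C, hC, ih⟩ := ih
    have h4 : (1 : ℝ) ≤ 4 ^ m := one_le_pow₀ (by norm_num)
    have hC' : 1 ≤ 2 * 4 ^ m * C * K := by
      have := one_le_mul_of_one_le_of_one_le (one_le_mul_of_one_le_of_one_le h4 hC) hK
      linarith
    refine ⟨2 * 4 ^ m * C * K, hC', fun {V _ _ f G A} hf hG hGK hGj => ?_⟩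
    have hd := fun x => (hf.2.1 (G x)).hasFDerivAt.comp x (hG x).hasFDerivAt
    refine ⟨fun x => (hf.1 _).trans (le_mul_of_one_le_left hf.nonneg hC'),
      fun x => (hd x).differentiableAt, ?_⟩
    rw [show fderiv ℝ (fun x => f (G x)) = fun x =>
      ContinuousLinearMap.compL ℝ E E V (fderiv ℝ f (G x)) (fderiv ℝ G x) from
      funext fun x => (hd x).fderiv]
    refine (HolderBdd.bilin hα hα1 (ih hf.2.2 hG hGK fun j hj => hGj j (hj.trans m.lt_succ_self))
      (hGj m m.lt_succ_self) (ContinuousLinearMap.compL ℝ E E V)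
      (ContinuousLinearMap.norm_compL_le ℝ E E V)).mono (le_of_eq (by ring))

/-- The displacement `F` of the map `x ↦ x + F x` and its derivatives are of size `h`. -/
structure NearId (α h : ℝ) (m : ℕ) (F : E → E) : Prop where
  differentiable : Differentiable ℝ F
  norm_le : ∀ x, ‖F x‖ ≤ h
  norm_fderiv_le : ∀ x, ‖fderiv ℝ F x‖ ≤ h
  holder : ∀ j < m, HolderBdd α h j (fderiv ℝ F)

namespace NearId

variable {h : ℝ} {m n : ℕ} {F : E → E}

lemma nonneg (hF : NearId α h m F) : 0 ≤ h := (norm_nonneg _).trans (hF.norm_le 0)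

lemma of_le (hF : NearId α h n F) (hmn : m ≤ n) : NearId α h m F :=
  ⟨hF.1, hF.2, hF.3, fun j hj => hF.4 j (hj.trans_le hmn)⟩

lemma hasFDerivAt_add (hF : NearId α h m F) (x : E) :
    HasFDerivAt (fun y => y + F y) (ContinuousLinearMap.id ℝ E + fderiv ℝ F x) x :=
  (hasFDerivAt_id x).add (hF.differentiable x).hasFDerivAt

lemma norm_fderiv_add_le (hF : NearId α h m F) (x : E) :
    ‖fderiv ℝ (fun y => y + F y) x‖ ≤ 1 + h := by
  rw [(hF.hasFDerivAt_add x).fderiv]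
  exact (norm_add_le _ _).trans (add_le_add ContinuousLinearMap.norm_id_le (hF.norm_fderiv_le x))

lemma comp (hα : 0 < α) (hα1 : α ≤ 1) (m : ℕ) {K : ℝ} (hK : 0 ≤ K) :
    ∃ C : ℝ, 1 ≤ C ∧ ∀ {V : Type} [NormedAddCommGroup V] [NormedSpace ℝ V] {f : E → V}
      {F : E → E} {A h : ℝ}, HolderBdd α A m f → h ≤ K → NearId α h m F →
      HolderBdd α (C * A) m (fun x => f (x + F x)) := by
  obtain ⟨C, hC, hcomp⟩ := HolderBdd.comp (E := E) hα hα1 m (K := 1 + K) (by linarith)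
  refine ⟨C, hC, fun {V _ _ f F A h} hf hh hF => ?_⟩
  refine hcomp hf (fun x => (hF.hasFDerivAt_add x).differentiableAt)
    (fun x => (hF.norm_fderiv_add_le x).trans (by linarith)) fun j hj => ?_
  rw [show fderiv ℝ (fun y => y + F y) = fun x => ContinuousLinearMap.id ℝ E + fderiv ℝ F x from
    funext fun x => (hF.hasFDerivAt_add x).fderiv]
  exact ((HolderBdd.const (ContinuousLinearMap.id ℝ E)).add (hF.holder j hj)).mono
    (add_le_add ContinuousLinearMap.norm_id_le hh)

variable {V : Type} [NormedAddCommGroup V] [NormedSpace ℝ V] {f : E → V}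

lemma hasFDerivAt_comp_sub (hF : NearId α h m F) (hf : Differentiable ℝ f) (x : E) :
    HasFDerivAt (fun y => f (y + F y) - f y)
      ((fderiv ℝ f (x + F x) - fderiv ℝ f x) +
        ContinuousLinearMap.compL ℝ E E V (fderiv ℝ f (x + F x)) (fderiv ℝ F x)) x := by
  have h1 := (hf (x + F x)).hasFDerivAt.comp x (hF.hasFDerivAt_add x)
  refine (h1.sub (hf x).hasFDerivAt).congr_fderiv ?_
  ext v
  simp
  abel

lemma norm_comp_sub_le (hF : NearId α h m F) (hf : Differentiable ℝ f) {A : ℝ}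
    (hA : ∀ x, ‖fderiv ℝ f x‖ ≤ A) (x : E) : ‖f (x + F x) - f x‖ ≤ A * h := by
  have hA0 : 0 ≤ A := (norm_nonneg _).trans (hA x)
  calc ‖f (x + F x) - f x‖ ≤ A * ‖x + F x - x‖ := norm_sub_le_of_fderiv_le hf hA _ _
    _ ≤ A * h := by
      gcongr
      simpa using hF.norm_le x

lemma norm_fderiv_compL_le (hF : NearId α h m F) {A : ℝ} (hA : ∀ x, ‖fderiv ℝ f x‖ ≤ A) (x : E) :
    ‖ContinuousLinearMap.compL ℝ E E V (fderiv ℝ f (x + F x)) (fderiv ℝ F x)‖ ≤ A * h := by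
  have hA0 : 0 ≤ A := (norm_nonneg _).trans (hA x)
  exact (ContinuousLinearMap.opNorm_comp_le _ _).trans
    (mul_le_mul (hA _) (hF.norm_fderiv_le x) (norm_nonneg _) hA0)

/-- For smooth `f`, the difference `f (x + F x) - f x` is as small and as regular as `F`. -/
lemma comp_sub_smooth (hα : 0 < α) (hα1 : α ≤ 1) (m : ℕ) {K : ℝ} (hK : 0 ≤ K) :
    ∃ C : ℝ, 0 ≤ C ∧ ∀ {V : Type} [NormedAddCommGroup V] [NormedSpace ℝ V] {f : E → V}
      {F : E → E} {A h : ℝ}, Differentiable ℝ f → HolderBdd 1 A (m + 1) (fderiv ℝ f) →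
      h ≤ K → NearId α h m F →
      HolderBdd α (C * A * h) m (fun x => f (x + F x) - f x) := by
  induction m with
  | zero =>
    refine ⟨4, by norm_num, fun {V _ _ f F A h} hf hfA hh hF => ?_⟩
    have hd := hF.hasFDerivAt_comp_sub hf
    have hAh : 0 ≤ A * h := mul_nonneg hfA.nonneg hF.nonneg
    refine (HolderBdd.of_fderiv_le (A := 2 * (A * h)) hα hα1
      (fun x => (hF.norm_comp_sub_le hf hfA.norm_le x).trans (by linarith))
      (fun x => (hd x).differentiableAt) fun x => ?_).mono (le_of_eq (by ring))
    rw [(hd x).fderiv]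
    refine (norm_add_le _ _).trans ?_
    linarith [hF.norm_comp_sub_le hfA.2.1 hfA.2.2.norm_le x, hF.norm_fderiv_compL_le hfA.norm_le x]
  | succ m ih =>
    obtain ⟨C, hC, ih⟩ := ih
    obtain ⟨C₁, hC₁, hcomp⟩ := comp (E := E) hα hα1 m hK
    refine ⟨C + 2 * 4 ^ m * C₁ * 8 + 1, by positivity, fun {V _ _ f F A h} hf hfA hh hF => ?_⟩
    have hd := hF.hasFDerivAt_comp_sub hf
    have hA := hfA.nonneg
    have hh0 := hF.nonneg
    refine ⟨fun x => (hF.norm_comp_sub_le hf hfA.norm_le x).trans ?_,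
      fun x => (hd x).differentiableAt, ?_⟩
    · have : 0 ≤ (C + 2 * 4 ^ m * C₁ * 8) * (A * h) := by positivity
      linarith
    rw [show fderiv ℝ (fun x => f (x + F x) - f x) = _ from funext fun x => (hd x).fderiv]
    have h1 := ih hfA.2.1 hfA.2.2 hh (hF.of_le m.le_succ)
    have hDf : HolderBdd α (8 * A) m (fderiv ℝ f) :=
      (((hfA.order_pred hα hα1).order_pred hα hα1).mono (by linarith))
    have h2 := HolderBdd.bilin hα hα1 (hcomp hDf hh (hF.of_le m.le_succ))
      (hF.holder m m.lt_succ_self) (ContinuousLinearMap.compL ℝ E E V)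
      (ContinuousLinearMap.norm_compL_le ℝ E E V)
    refine (h1.add h2).mono ?_
    have : 0 ≤ A * h := by positivity
    linarith

end NearId

end NearIdentity

section AlgebraicOperations

variable {E : Type} [NormedAddCommGroup E] [NormedSpace ℝ E] {α : ℝ}

/-- The pointwise inverse of a Hölder function with values in a Banach algebra. -/
lemma HolderBdd.inverse {R : Type} [NormedRing R] [NormedAlgebra ℝ R] [CompleteSpace R]
    (hα : 0 < α) (hα1 : α ≤ 1) (m : ℕ) {a κ : ℝ} :
    ∃ C : ℝ, ∀ M B : E → R, (∀ x, B x * M x = 1) → (∀ x, M x * B x = 1) → (∀ x, ‖B x‖ ≤ κ) →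
      HolderBdd α a m M → HolderBdd α C m B := by
  induction m generalizing a with
  | zero =>
    refine ⟨κ + κ * a * κ, fun M B hBM hMB hκ hM => ?_⟩
    have hκ0 : 0 ≤ κ := (norm_nonneg _).trans (hκ 0)
    have ha := hM.nonneg
    refine ⟨fun x => (hκ x).trans (le_add_of_nonneg_right (by positivity)), fun x y => ?_⟩
    have e : B x - B y = B x * (M y - M x) * B y := by
      rw [mul_sub, hBM, sub_mul, mul_assoc, hMB, mul_one, one_mul]
    calc ‖B x - B y‖ ≤ ‖B x‖ * ‖M y - M x‖ * ‖B y‖ := by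
          rw [e]
          exact (norm_mul_le _ _).trans (by gcongr; exact norm_mul_le _ _)
      _ ≤ κ * (a * ‖x - y‖ ^ α) * κ := by
        gcongr
        · exact hκ x
        · rw [norm_sub_rev]; exact hM.2 x y
        · exact hκ y
      _ ≤ (κ + κ * a * κ) * ‖x - y‖ ^ α := by
        have : 0 ≤ κ * ‖x - y‖ ^ α := by positivity
        linarith
  | succ m ih =>
    obtain ⟨C, ih⟩ := ih (a := 2 * a)
    refine ⟨|κ| + 2 * 4 ^ m * 1 * (2 * 4 ^ m * 1 * C * C) * a, fun M B hBM hMB hκ hM => ?_⟩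
    have hB := ih M B hBM hMB hκ (hM.order_pred hα hα1)
    have ha := hM.nonneg
    have hC := hB.nonneg
    have hx : ∀ x, Ring.inverse (M x) = B x := fun x =>
      Ring.inverse_unit (⟨M x, B x, hMB x, hBM x⟩ : Rˣ)
    have hd : ∀ x, HasFDerivAt B
        (-ContinuousLinearMap.compL ℝ E R R (ContinuousLinearMap.mulLeftRight ℝ R (B x) (B x))
          (fderiv ℝ M x)) x := fun x => by
      have h := (hasFDerivAt_ringInverse (𝕜 := ℝ) (⟨M x, B x, hMB x, hBM x⟩ : Rˣ)).comp x
        (hM.2.1 x).hasFDerivAt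
      rw [show Ring.inverse ∘ M = B from funext hx] at h
      refine h.congr_fderiv ?_
      ext v
      simp
    refine ⟨fun x => (hκ x).trans ((le_abs_self κ).trans
      (le_add_of_nonneg_right (by positivity))), fun x => (hd x).differentiableAt, ?_⟩
    rw [show fderiv ℝ B = _ from funext fun x => (hd x).fderiv]
    refine (HolderBdd.neg (HolderBdd.bilin hα hα1 (HolderBdd.bilin hα hα1 hB hB
      (ContinuousLinearMap.mulLeftRight ℝ R) (ContinuousLinearMap.opNorm_mulLeftRight_le ℝ R))
      hM.2.2 (ContinuousLinearMap.compL ℝ E R R)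
      (ContinuousLinearMap.norm_compL_le ℝ E R R))).mono ?_
    exact le_add_of_nonneg_left (abs_nonneg κ)

lemma Real.abs_exp_sub_exp_le {K u v : ℝ} (hu : u ≤ K) (hv : v ≤ K) :
    |Real.exp u - Real.exp v| ≤ Real.exp K * |u - v| := by
  wlog huv : v ≤ u generalizing u v
  · rw [abs_sub_comm, abs_sub_comm u]
    exact this hv hu (le_of_not_ge huv)
  rw [abs_of_nonneg (sub_nonneg.2 (Real.exp_le_exp.2 huv)), abs_of_nonneg (sub_nonneg.2 huv)]
  have h1 : Real.exp v = Real.exp u * Real.exp (v - u) := by rw [← Real.exp_add]; ring_nf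
  have h2 := mul_le_mul_of_nonneg_left (Real.add_one_le_exp (v - u)) (Real.exp_pos u).le
  have h3 := mul_le_mul_of_nonneg_right (Real.exp_le_exp.2 hu) (sub_nonneg.2 huv)
  linarith

lemma HolderBdd.exp_sub_one (hα : 0 < α) (hα1 : α ≤ 1) (m : ℕ) {K : ℝ} (hK : 0 ≤ K) :
    ∃ C : ℝ, 0 ≤ C ∧ ∀ (u : E → ℝ) (a : ℝ), a ≤ K → HolderBdd α a m u →
      HolderBdd α (C * a) m (fun x => Real.exp (u x) - 1) := by
  induction m generalizing K with
  | zero =>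
    refine ⟨Real.exp K, (Real.exp_pos K).le, fun u a ha hu => ?_⟩
    have huK : ∀ x, u x ≤ K := fun x => (le_abs_self _).trans ((hu.1 x).trans ha)
    refine ⟨fun x => ?_, fun x y => ?_⟩
    · have := Real.abs_exp_sub_exp_le (huK x) hK
      simp only [Real.exp_zero, sub_zero] at this
      exact this.trans (mul_le_mul_of_nonneg_left (hu.1 x) (Real.exp_pos K).le)
    · rw [sub_sub_sub_cancel_right, mul_assoc]
      exact (Real.abs_exp_sub_exp_le (huK x) (huK y)).trans
        (mul_le_mul_of_nonneg_left (hu.2 x y) (Real.exp_pos K).le)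
  | succ m ih =>
    obtain ⟨C, hC, ih⟩ := ih (K := 2 * K) (by linarith)
    refine ⟨2 * C + 2 * 4 ^ m * 1 * (2 * C) * K + 1, by positivity, fun u a ha hu => ?_⟩
    have ha0 := hu.nonneg
    have he := ih u (2 * a) (by linarith) (hu.order_pred hα hα1)
    have hd : ∀ x, HasFDerivAt (fun x => Real.exp (u x) - 1)
        (ContinuousLinearMap.lsmul ℝ ℝ (Real.exp (u x) - 1) (fderiv ℝ u x) + fderiv ℝ u x) x := by
      intro x
      refine ((hu.2.1 x).hasFDerivAt.exp.sub_const 1).congr_fderiv ?_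
      ext v
      simp
    have h1 : 0 ≤ 2 * 4 ^ m * 1 * (2 * C) * K * a := by positivity
    refine ⟨fun x => (he.norm_le x).trans (by linarith), fun x => (hd x).differentiableAt, ?_⟩
    rw [show fderiv ℝ (fun x => Real.exp (u x) - 1) = _ from funext fun x => (hd x).fderiv]
    refine ((HolderBdd.bilin hα hα1 he hu.2.2 (ContinuousLinearMap.lsmul ℝ ℝ)
      ContinuousLinearMap.opNorm_lsmul_le).add hu.2.2).mono ?_
    have h2 : 2 * 4 ^ m * 1 * (2 * C) * a * a ≤ 2 * 4 ^ m * 1 * (2 * C) * K * a := by gcongr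
    have h3 : 0 ≤ 2 * C * a := by positivity
    linarith

end AlgebraicOperations

section Weight

/-- Derivatives of `(1 + ‖x‖ ^ 2)⁻¹` and `(1 + ‖x‖ ^ 2)⁻¹ • ⟪x, ·⟫` are polynomials in these
functions, so all of them are bounded. -/
lemma holderBdd_inv_one_add_norm_sq {E : Type} [NormedAddCommGroup E] [InnerProductSpace ℝ E]
    (m : ℕ) : ∃ C : ℝ, HolderBdd 1 C m (fun x : E => (1 + ‖x‖ ^ 2)⁻¹) ∧
      HolderBdd 1 C m (fun x : E => (1 + ‖x‖ ^ 2)⁻¹ • innerSL ℝ x) := by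
  set p : E → ℝ := fun x => (1 + ‖x‖ ^ 2)⁻¹ with hp
  set q : E → E →L[ℝ] ℝ := fun x => p x • innerSL ℝ x with hq
  let J : E →L[ℝ] E →L[ℝ] ℝ := innerSL ℝ
  have hpos : ∀ x : E, 0 < 1 + ‖x‖ ^ 2 := fun x => by positivity
  have hdp : ∀ x, HasFDerivAt p ((-2 : ℝ) • ContinuousLinearMap.lsmul ℝ ℝ (p x) (q x)) x := by
    intro x
    have h1 : HasFDerivAt (fun x : E => 1 + ‖x‖ ^ 2) (2 • innerSL ℝ x) x :=
      ((hasStrictFDerivAt_norm_sq x).hasFDerivAt).const_add 1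
    have h2 := (hasDerivAt_inv (hpos x).ne').comp_hasFDerivAt x h1
    refine h2.congr_fderiv ?_
    ext v
    simp [hp, hq]
    field_simp
  have hdq : ∀ x, HasFDerivAt q ((ContinuousLinearMap.id ℝ ℝ).smulRight J (p x)
      + (-2 : ℝ) • ContinuousLinearMap.smulRightL ℝ E (E →L[ℝ] ℝ) (q x) (q x)) x := by
    intro x
    refine ((hdp x).smul J.hasFDerivAt).congr_fderiv ?_
    ext v w
    have hJ : ∀ u, J u w = inner ℝ u w := fun _ => rfl
    simp [hq, hJ]
    ring
  have hpb : ∀ x, ‖p x‖ ≤ 1 := fun x => by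
    rw [Real.norm_of_nonneg (inv_pos.2 (hpos x)).le]
    exact inv_le_one_of_one_le₀ (by nlinarith [sq_nonneg ‖x‖])
  have hqb : ∀ x, ‖q x‖ ≤ 1 := fun x => by
    rw [hq, norm_smul, innerSL_apply_norm, Real.norm_of_nonneg (inv_pos.2 (hpos x)).le,
      inv_mul_le_iff₀ (hpos x)]
    nlinarith [sq_nonneg (‖x‖ - 1), sq_nonneg ‖x‖]
  have hsucc : ∀ (n : ℕ) (C : ℝ), HolderBdd 1 C n p → HolderBdd 1 C n q → ∃ C' : ℝ,
      HolderBdd 1 C' n (fderiv ℝ p) ∧ HolderBdd 1 C' n (fderiv ℝ q) := by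
    intro n C h1 h2
    rw [show fderiv ℝ p = _ from funext fun x => (hdp x).fderiv,
      show fderiv ℝ q = _ from funext fun x => (hdq x).fderiv]
    have h3 := (HolderBdd.bilin one_pos le_rfl h1 h2 (ContinuousLinearMap.lsmul ℝ ℝ)
      le_rfl).clm ((-2 : ℝ) • ContinuousLinearMap.id ℝ _) le_rfl
    have h4 := (h1.clm ((ContinuousLinearMap.id ℝ ℝ).smulRight J) le_rfl).add
      ((HolderBdd.bilin one_pos le_rfl h2 h2 (ContinuousLinearMap.smulRightL ℝ E (E →L[ℝ] ℝ))
      le_rfl).clm ((-2 : ℝ) • ContinuousLinearMap.id ℝ _) le_rfl)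
    exact ⟨_, h3.mono (le_max_left _ _), h4.mono (le_max_right _ _)⟩
  induction m with
  | zero =>
    have hle : ∀ x y : ℝ, 0 ≤ x → 0 ≤ y → x ≤ 1 → y ≤ 1 → x * y ≤ 1 := fun x y hx hy h h' =>
      mul_le_one₀ h hy h'
    have hp' : ∀ x, ‖fderiv ℝ p x‖ ≤ 2 := fun x => by
      rw [(hdp x).fderiv, norm_smul, ContinuousLinearMap.lsmul_apply, norm_smul, norm_neg,
        Real.norm_ofNat]
      linarith [hle _ _ (norm_nonneg _) (norm_nonneg _) (hpb x) (hqb x)]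
    set c := ‖J‖
    have hq' : ∀ x, ‖fderiv ℝ q x‖ ≤ c + 2 := fun x => by
      rw [(hdq x).fderiv]
      refine (ContinuousLinearMap.opNorm_add_le _ _).trans (add_le_add ?_ ?_)
      · simp only [ContinuousLinearMap.smulRight_apply, ContinuousLinearMap.id_apply, norm_smul]
        exact mul_le_of_le_one_left (norm_nonneg _) (hpb x)
      · rw [norm_smul, norm_neg, Real.norm_ofNat]
        have := (ContinuousLinearMap.smulRightL ℝ E (E →L[ℝ] ℝ)).le_of_opNorm₂_le_of_le
          ContinuousLinearMap.norm_smulRightL_le (hqb x) (hqb x)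
        linarith
    have hc : 0 ≤ c := norm_nonneg J
    exact ⟨2 * (c + 2), HolderBdd.of_fderiv_le one_pos le_rfl
      (fun x => (hpb x).trans (by linarith)) (fun x => (hdp x).differentiableAt)
      (fun x => (hp' x).trans (by linarith)), HolderBdd.of_fderiv_le one_pos le_rfl
      (fun x => (hqb x).trans (by linarith)) (fun x => (hdq x).differentiableAt) hq'⟩
  | succ m ih =>
    obtain ⟨C, h1, h2⟩ := ih
    obtain ⟨C', h3, h4⟩ := hsucc m C h1 h2
    have h := le_max_left 1 C'
    have h' := le_max_right 1 C'
    exact ⟨max 1 C', ⟨fun x => (hpb x).trans h, fun x => (hdp x).differentiableAt, h3.mono h'⟩,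
      ⟨fun x => (hqb x).trans h, fun x => (hdq x).differentiableAt, h4.mono h'⟩⟩

lemma r1_pos {d : ℕ} (x : Euc d) : 0 < r1 x := Real.sqrt_pos.2 (by positivity)

lemma hasFDerivAt_log_r1 {d : ℕ} (x : Euc d) :
    HasFDerivAt (fun y : Euc d => Real.log (r1 y)) ((1 + ‖x‖ ^ 2)⁻¹ • innerSL ℝ x) x := by
  have hpos : 0 < 1 + ‖x‖ ^ 2 := by positivity
  have h1 : HasFDerivAt (fun x : Euc d => 1 + ‖x‖ ^ 2) (2 • innerSL ℝ x) x :=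
    ((hasStrictFDerivAt_norm_sq x).hasFDerivAt).const_add 1
  have h2 := (h1.log hpos.ne').const_mul (1 / 2)
  have e : (fun y : Euc d => Real.log (r1 y)) = fun y => 1 / 2 * Real.log (1 + ‖y‖ ^ 2) :=
    funext fun y => by rw [r1, Real.log_sqrt (by positivity)]; ring
  rw [e]
  refine h2.congr_fderiv ?_
  ext v
  simp
  ring

lemma contDiff_r1_rpow {d : ℕ} (θ : ℝ) {n : WithTop ℕ∞} :
    ContDiff ℝ n (fun x : Euc d => r1 x ^ θ) := by
  have h : ContDiff ℝ n (fun x : Euc d => r1 x) :=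
    (contDiff_const.add (contDiff_norm_sq ℝ)).sqrt fun x => by positivity
  exact h.rpow_const_of_ne fun x => ne_of_gt (r1_pos x)

/-- The ratio of the weights at `x + F x` and at `x` is close to `1`. -/
lemma holderBdd_weight_ratio (d : ℕ) {α θ K : ℝ} (hα : 0 < α) (hα1 : α ≤ 1) (hθ : 0 ≤ θ)
    (hK : 0 ≤ K) (m : ℕ) : ∃ C : ℝ, 0 ≤ C ∧ ∀ (F : Euc d → Euc d) (h : ℝ), h ≤ K →
      NearId α h m F → HolderBdd α (C * h) m (fun x => r1 x ^ (-θ) * r1 (x + F x) ^ θ - 1) := by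
  obtain ⟨A, _, hA⟩ := holderBdd_inv_one_add_norm_sq (E := Euc d) (m + 1)
  obtain ⟨C₁, hC₁, hsub⟩ := NearId.comp_sub_smooth (E := Euc d) hα hα1 m hK
  have hA0 := hA.nonneg
  obtain ⟨C₂, hC₂, hexp⟩ := HolderBdd.exp_sub_one (E := Euc d) (K := θ * (C₁ * A * K)) hα hα1 m
    (by positivity)
  refine ⟨C₂ * (θ * (C₁ * A)), by positivity, fun F h hh hF => ?_⟩
  rw [← show fderiv ℝ (fun y : Euc d => Real.log (r1 y)) = _ from
    funext fun x => (hasFDerivAt_log_r1 x).fderiv] at hA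
  have hu := (hsub (fun x => (hasFDerivAt_log_r1 x).differentiableAt) hA hh hF).const_smul hθ
  have he := hexp _ _ (by gcongr) hu
  have e : (fun x => r1 x ^ (-θ) * r1 (x + F x) ^ θ - 1) = fun x =>
      Real.exp (θ • (Real.log (r1 (x + F x)) - Real.log (r1 x))) - 1 := funext fun x => by
    rw [Real.rpow_def_of_pos (r1_pos x), Real.rpow_def_of_pos (r1_pos _), ← Real.exp_add,
      smul_eq_mul]
    ring_nf
  rw [e]
  exact he.mono (le_of_eq (by ring))

end Weight

section InverseMap

variable {E : Type} [NormedAddCommGroup E] [NormedSpace ℝ E] [CompleteSpace E]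

lemma hasFDerivAt_of_leftInverse {H G : E → E} {B : E →L[ℝ] E} (hH : ContDiff ℝ 1 H)
    (hl : Function.LeftInverse G (fun x => x + H x))
    (hr : Function.RightInverse G (fun x => x + H x))
    (y : E) (h1 : (1 + fderiv ℝ H (G y)) * B = 1) (h2 : B * (1 + fderiv ℝ H (G y)) = 1) :
    HasFDerivAt G B y := by
  have hs : HasStrictFDerivAt (fun x => x + H x)
      (ContinuousLinearMap.id ℝ E + fderiv ℝ H (G y)) (G y) :=
    (hasStrictFDerivAt_id _).add (hH.contDiffAt.hasStrictFDerivAt (by norm_num))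
  let e : E ≃L[ℝ] E := ContinuousLinearEquiv.equivOfInverse
    (ContinuousLinearMap.id ℝ E + fderiv ℝ H (G y)) B
    (fun v => congrArg (fun L : E →L[ℝ] E => L v) h2)
    (fun v => congrArg (fun L : E →L[ℝ] E => L v) h1)
  have hs' : HasStrictFDerivAt (fun x => x + H x) (e : E →L[ℝ] E) (G y) := hs
  have h := (hs'.to_local_left_inverse (g := G) (Filter.Eventually.of_forall hl)).hasFDerivAt
  have hy : G y + H (G y) = y := hr y
  simp only [hy] at h
  exact h

/-- The inverse of `x ↦ x + H x` is a perturbation of the identity of the same size as `H`. -/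
lemma nearId_inverse {α κ K : ℝ} (hα : 0 < α) (hα1 : α ≤ 1) (m : ℕ) :
    ∃ C : ℝ, 0 ≤ C ∧ ∀ (H G : E → E) (h : ℝ), h ≤ K → ContDiff ℝ 1 H →
      (∀ x, ∃ B : E →L[ℝ] E,
        (1 + fderiv ℝ H x) * B = 1 ∧ B * (1 + fderiv ℝ H x) = 1 ∧ ‖B‖ ≤ κ) →
      Function.LeftInverse G (fun x => x + H x) → Function.RightInverse G (fun x => x + H x) →
      NearId α h m H → NearId α (C * h) m (fun x => G x - x) := by
  have hder : ∃ C : ℝ, 1 ≤ C ∧ κ ≤ C ∧ ∀ (H G : E → E) (h : ℝ) (B : E → E →L[ℝ] E), h ≤ K →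
      (∀ y, (1 + fderiv ℝ H (G y)) * B y = 1) → (∀ y, B y * (1 + fderiv ℝ H (G y)) = 1) →
      (∀ y, ‖B y‖ ≤ κ) → (∀ y, HasFDerivAt G (B y) y) → NearId α h m H → ∀ j < m,
      HolderBdd α C j (fderiv ℝ G) ∧ HolderBdd α (C * h) j (fderiv ℝ (fun x => G x - x)) := by
    induction m with
    | zero =>
      exact ⟨max 1 κ, le_max_left _ _, le_max_right _ _, fun _ _ _ _ _ _ _ _ _ _ j hj =>
        absurd hj (Nat.not_lt_zero j)⟩
    | succ m ih =>
      obtain ⟨C₀, hC₀, hκC₀, ih⟩ := ih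
      obtain ⟨C₁, hC₁, hcomp⟩ := HolderBdd.comp (E := E) hα hα1 m hC₀
      obtain ⟨C₂, hinv⟩ := HolderBdd.inverse (E := E) (R := E →L[ℝ] E) hα hα1 m
        (a := 1 + C₁ * K) (κ := κ)
      refine ⟨max C₀ (max C₂ (2 * 4 ^ m * 1 * C₁ * C₂)), hC₀.trans (le_max_left _ _),
        hκC₀.trans (le_max_left _ _), fun H G h B hh h1 h2 hB hG hH j hj => ?_⟩
      have hh0 := hH.nonneg
      have hj' := ih H G h B hh h1 h2 hB hG (hH.of_le m.le_succ)
      rcases Nat.lt_succ_iff_lt_or_eq.1 hj with hj | rfl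
      · obtain ⟨h3, h4⟩ := hj' j hj
        exact ⟨h3.mono (le_max_left _ _), h4.mono (by gcongr; exact le_max_left _ _)⟩
      have hBG : fderiv ℝ G = B := funext fun y => (hG y).fderiv
      have hDH := hcomp (hH.holder j j.lt_succ_self) (fun y => (hG y).differentiableAt)
        (fun y => by rw [hBG]; exact (hB y).trans hκC₀) (fun i hi => (hj' i hi).1)
      have hM : HolderBdd α (1 + C₁ * K) j (fun y => (1 : E →L[ℝ] E) + fderiv ℝ H (G y)) :=
        ((HolderBdd.const (1 : E →L[ℝ] E)).add hDH).mono
          (add_le_add ContinuousLinearMap.norm_id_le (by gcongr))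
      have hBH := hinv _ B h2 h1 hB hM
      have hdF : fderiv ℝ (fun x => G x - x) = fun y => -(ContinuousLinearMap.compL ℝ E E E
          (fderiv ℝ H (G y)) (B y)) := funext fun y => by
        rw [show fderiv ℝ (fun x => G x - x) y = _ from ((hG y).sub (hasFDerivAt_id y)).fderiv]
        have := h1 y
        rw [add_mul, one_mul] at this
        exact sub_eq_of_eq_add (by rw [neg_add_eq_sub]; exact eq_sub_of_add_eq this)
      refine ⟨by rw [hBG]; exact hBH.mono ((le_max_left _ _).trans (le_max_right _ _)), ?_⟩
      rw [hdF]
      refine (HolderBdd.bilin hα hα1 hDH hBH (ContinuousLinearMap.compL ℝ E E E)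
        (ContinuousLinearMap.norm_compL_le ℝ E E E)).neg.mono ?_
      calc 2 * 4 ^ j * 1 * (C₁ * h) * C₂ = 2 * 4 ^ j * 1 * C₁ * C₂ * h := by ring
        _ ≤ _ := by gcongr; exact (le_max_right _ _).trans (le_max_right _ _)
  obtain ⟨C, hC, hκC, hder⟩ := hder
  refine ⟨C, by linarith, fun H G h hh hH1 hB hl hr hH => ?_⟩
  choose B h1 h2 hBκ using hB
  have hh0 := hH.nonneg
  have hG : ∀ y, HasFDerivAt G (B (G y)) y := fun y =>
    hasFDerivAt_of_leftInverse hH1 hl hr y (h1 _) (h2 _)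
  refine ⟨fun y => ((hG y).sub (hasFDerivAt_id y)).differentiableAt, fun y => ?_, fun y => ?_,
    fun j hj => (hder H G h (fun y => B (G y)) hh (fun y => h1 _) (fun y => h2 _)
      (fun y => hBκ _) hG hH j hj).2⟩
  · have hy : G y + H (G y) = y := hr y
    calc ‖G y - y‖ = ‖H (G y)‖ := by
          rw [show G y - y = -H (G y) by rw [← sub_eq_zero]; nth_rewrite 2 [← hy]; abel, norm_neg]
      _ ≤ h := hH.norm_le _
      _ ≤ C * h := le_mul_of_one_le_left hh0 hC
  · have e : B (G y) - ContinuousLinearMap.id ℝ E = -(fderiv ℝ H (G y) * B (G y)) := by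
      have := h1 (G y)
      rw [add_mul, one_mul] at this
      exact sub_eq_of_eq_add (by rw [neg_add_eq_sub]; exact eq_sub_of_add_eq this)
    rw [show fderiv ℝ (fun x => G x - x) y = _ from ((hG y).sub (hasFDerivAt_id y)).fderiv,
      e, norm_neg]
    calc ‖fderiv ℝ H (G y) * B (G y)‖ ≤ h * κ := (ContinuousLinearMap.opNorm_comp_le _ _).trans
          (mul_le_mul (hH.norm_fderiv_le _) (hBκ _) (norm_nonneg _) hh0)
      _ ≤ C * h := by rw [mul_comm]; gcongr

end InverseMap

section TopOrder

variable {E V : Type} [NormedAddCommGroup E] [NormedSpace ℝ E]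
  [NormedAddCommGroup V] [NormedSpace ℝ V] {f : E → V} {F : E → E} {α μ : ℝ}

lemma norm_add_sub_add_le {E : Type*} [NormedAddCommGroup E] {F : E → E} {h₁ : ℝ}
    (hF : ∀ x y, ‖F x - F y‖ ≤ h₁ * ‖x - y‖) (x y : E) :
    ‖x + F x - (y + F y)‖ ≤ (1 + h₁) * ‖x - y‖ := by
  rw [add_sub_add_comm]
  exact (norm_add_le _ _).trans (by linarith [hF x y])

/-- Composition with a perturbation of the identity: loss of `μ` Hölder derivatives, below order
one. -/
lemma holderBdd_comp_sub_of_holder {B L K : ℝ} (hα : 0 < α) (hμ : 0 < μ)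
    (hαμ : α + μ ≤ 1) (hB : 0 ≤ B) (hL : 0 ≤ L) (hK : 0 ≤ K)
    (hf : ∀ x y, ‖f x - f y‖ ≤ B * ‖x - y‖ ^ (α + μ)) (hF : ∀ x, ‖F x‖ ≤ L)
    (hF' : ∀ x y, ‖F x - F y‖ ≤ K * ‖x - y‖) :
    HolderBdd α ((L ^ α + 4 + K) * (B * L ^ μ)) 0 (fun x => f (x + F x) - f x) := by
  have hLα : 0 ≤ L ^ α := Real.rpow_nonneg hL α
  have hBL : 0 ≤ B * L ^ μ := by positivity
  have hsup : ∀ x, ‖f (x + F x) - f x‖ ≤ L ^ α * (B * L ^ μ) := fun x => by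
    calc ‖f (x + F x) - f x‖ ≤ B * ‖F x‖ ^ (α + μ) := by simpa using hf (x + F x) x
      _ ≤ B * L ^ (α + μ) := by gcongr; exact hF x
      _ = _ := by rw [Real.rpow_add' hL (by positivity)]; ring
  refine ⟨fun x => (hsup x).trans (by gcongr; linarith), fun x y => ?_⟩
  rcases le_total L ‖x - y‖ with h | h
  · calc ‖f (x + F x) - f x - (f (y + F y) - f y)‖
        ≤ L ^ α * (B * L ^ μ) + L ^ α * (B * L ^ μ) :=
          (norm_sub_le _ _).trans (add_le_add (hsup x) (hsup y))
      _ = 2 * (B * L ^ μ) * L ^ α := by ring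
      _ ≤ (L ^ α + 4 + K) * (B * L ^ μ) * ‖x - y‖ ^ α := by gcongr; linarith
  · have hr : ‖x - y‖ ^ (α + μ) ≤ ‖x - y‖ ^ α * L ^ μ := by
      rw [Real.rpow_add' (norm_nonneg _) (by positivity)]
      gcongr
    have h1 : ‖f (x + F x) - f (y + F y)‖ ≤ B * ((1 + K) * (‖x - y‖ ^ α * L ^ μ)) := by
      calc ‖f (x + F x) - f (y + F y)‖ ≤ B * ‖x + F x - (y + F y)‖ ^ (α + μ) := hf _ _
        _ ≤ B * ((1 + K) * ‖x - y‖) ^ (α + μ) := by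
          gcongr
          exact norm_add_sub_add_le hF' x y
        _ ≤ B * ((1 + K) * (‖x - y‖ ^ α * L ^ μ)) := by
          rw [Real.mul_rpow (by linarith) (norm_nonneg _)]
          gcongr
          simpa using Real.rpow_le_rpow_of_exponent_le (by linarith : 1 ≤ 1 + K) hαμ
    have h2 : ‖f x - f y‖ ≤ B * (‖x - y‖ ^ α * L ^ μ) := (hf x y).trans (by gcongr)
    have h3 : 0 ≤ L ^ α * (B * L ^ μ) * ‖x - y‖ ^ α := by positivity
    have h4 : 0 ≤ B * L ^ μ * ‖x - y‖ ^ α := by positivity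
    rw [sub_sub_sub_comm]
    refine (norm_sub_le _ _).trans ?_
    linarith

/-- Interpolation: the gradient is controlled by the function and a Hölder seminorm of the
gradient. -/
lemma norm_fderiv_le_of_holder {A B δ : ℝ} (hδ : 0 ≤ δ) (hfd : Differentiable ℝ f)
    (hA : ∀ x, ‖f x‖ ≤ A) (hB : 0 ≤ B)
    (hf : ∀ x y, ‖fderiv ℝ f x - fderiv ℝ f y‖ ≤ B * ‖x - y‖ ^ δ) (x : E) :
    ‖fderiv ℝ f x‖ ≤ 2 * A + B := by
  have hA0 : 0 ≤ A := (norm_nonneg _).trans (hA x)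
  refine ContinuousLinearMap.opNorm_le_of_unit_norm (by linarith) fun v hv => ?_
  have h : ‖f (x + v) - f x - fderiv ℝ f x (x + v - x)‖ ≤ B * ‖x + v - x‖ := by
    refine (convex_closedBall x 1).norm_image_sub_le_of_norm_fderiv_le' (fun z _ => hfd z)
      (fun z hz => (hf z x).trans ?_) (by simp) (by simp [hv])
    refine mul_le_of_le_one_right hB (Real.rpow_le_one (norm_nonneg _) ?_ hδ)
    simpa [dist_eq_norm] using hz
  simp only [add_sub_cancel_left, hv, mul_one] at h
  calc ‖fderiv ℝ f x v‖ = ‖f (x + v) - f x - (f (x + v) - f x - fderiv ℝ f x v)‖ := by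
        congr 1; abel
    _ ≤ ‖f (x + v)‖ + ‖f x‖ + ‖f (x + v) - f x - fderiv ℝ f x v‖ :=
      (norm_sub_le _ _).trans (by gcongr; exact norm_sub_le _ _)
    _ ≤ 2 * A + B := by linarith [hA (x + v), hA x]

/-- Comparison of the increments of `f` along two segments at distance at most `ρ`. -/
lemma norm_increment_sub_le {A₁ B δ ρ : ℝ} (hδ : 0 ≤ δ) (hfd : Differentiable ℝ f)
    (hA₁ : ∀ x, ‖fderiv ℝ f x‖ ≤ A₁) (hB : 0 ≤ B)
    (hf : ∀ x y, ‖fderiv ℝ f x - fderiv ℝ f y‖ ≤ B * ‖x - y‖ ^ δ) (p p' v v' : E)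
    (hρ : ∀ t ∈ Set.Icc (0 : ℝ) 1, ‖p + t • v - (p' + t • v')‖ ≤ ρ) :
    ‖(f (p + v) - f p) - (f (p' + v') - f p')‖ ≤ B * ρ ^ δ * ‖v‖ + A₁ * ‖v - v'‖ := by
  set g : ℝ → V := fun t => f (p + t • v) - f (p' + t • v') with hg
  have hline : ∀ (q w : E) (t : ℝ),
      HasDerivAt (fun s : ℝ => f (q + s • w)) (fderiv ℝ f (q + t • w) w) t := fun q w t => by
    have h1 : HasDerivAt (fun s : ℝ => q + s • w) w t := by
      simpa using ((hasDerivAt_id t).smul_const w).const_add q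
    exact (hfd (q + t • w)).hasFDerivAt.comp_hasDerivAt t h1
  have hd : ∀ t, HasDerivAt g (fderiv ℝ f (p + t • v) v - fderiv ℝ f (p' + t • v') v') t :=
    fun t => (hline p v t).sub (hline p' v' t)
  have hbound : ∀ t ∈ Set.Icc (0 : ℝ) 1,
      ‖fderiv ℝ f (p + t • v) v - fderiv ℝ f (p' + t • v') v'‖ ≤
        B * ρ ^ δ * ‖v‖ + A₁ * ‖v - v'‖ := fun t ht => by
    calc ‖fderiv ℝ f (p + t • v) v - fderiv ℝ f (p' + t • v') v'‖
        = ‖(fderiv ℝ f (p + t • v) - fderiv ℝ f (p' + t • v')) v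
            + fderiv ℝ f (p' + t • v') (v - v')‖ := by congr 1; simp
      _ ≤ B * ρ ^ δ * ‖v‖ + A₁ * ‖v - v'‖ := by
        refine (norm_add_le _ _).trans (add_le_add ?_ (ContinuousLinearMap.le_of_opNorm_le _
          (hA₁ _) _))
        refine ContinuousLinearMap.le_of_opNorm_le _ ((hf _ _).trans ?_) _
        gcongr
        exact hρ t ht
  have h := (convex_Icc (0 : ℝ) 1).norm_image_sub_le_of_norm_hasDerivWithin_le
    (fun t _ => (hd t).hasDerivWithinAt) hbound (Set.left_mem_Icc.2 zero_le_one)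
    (Set.right_mem_Icc.2 zero_le_one)
  simp only [hg, one_smul, zero_smul, add_zero, sub_zero, norm_one, mul_one] at h
  rwa [sub_sub_sub_comm]

/-- Composition with a perturbation of the identity: loss of `μ` Hölder derivatives, above order
one. -/
lemma holderBdd_comp_sub_of_fderiv_holder {A A₁ B L K h₀ h₁ : ℝ} (hα : 0 < α) (hα1 : α ≤ 1)
    (hμ : 0 < μ) (hμ1 : μ ≤ 1) (hαμ : 1 < α + μ) (hB : 0 ≤ B)
    (hfd : Differentiable ℝ f) (hA : ∀ x, ‖f x‖ ≤ A) (hA₁ : ∀ x, ‖fderiv ℝ f x‖ ≤ A₁)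
    (hf : ∀ x y, ‖fderiv ℝ f x - fderiv ℝ f y‖ ≤ B * ‖x - y‖ ^ (α + μ - 1))
    (hF : ∀ x, ‖F x‖ ≤ h₀) (hh₀ : h₀ ≤ L) (hF' : ∀ x y, ‖F x - F y‖ ≤ h₁ * ‖x - y‖)
    (hh₁0 : 0 ≤ h₁) (hh₁ : h₁ ≤ K) :
    HolderBdd α ((4 + 2 * L ^ (1 - μ) + K + 1) * (A * h₀ + B * L ^ μ + A₁ * h₁)) 0
      (fun x => f (x + F x) - f x) := by
  have hh₀0 : 0 ≤ h₀ := (norm_nonneg _).trans (hF 0)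
  have hA0 : 0 ≤ A := (norm_nonneg _).trans (hA 0)
  have hA₁0 : 0 ≤ A₁ := (norm_nonneg _).trans (hA₁ 0)
  have hL : 0 ≤ L := hh₀0.trans hh₀
  have hK : 0 ≤ K := hh₁0.trans hh₁
  have hLμ : L ^ (1 - μ) * L ^ μ = L := by
    rw [← Real.rpow_add' hL (by simp)]; simp
  have hA₁h : 0 ≤ A₁ * h₁ := by positivity
  have hBL : 0 ≤ B * L ^ μ := by positivity
  have hAh : 0 ≤ A * h₀ := by positivity
  have hL1 : 0 ≤ L ^ (1 - μ) := by positivity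
  have hsup : ∀ x, ‖f (x + F x) - f x‖ ≤ 2 * (A * h₀) + L ^ (1 - μ) * (B * L ^ μ) := fun x => by
    calc ‖f (x + F x) - f x‖ ≤ (2 * A + B) * ‖F x‖ := by
          simpa using norm_sub_le_of_fderiv_le hfd
            (norm_fderiv_le_of_holder (by linarith) hfd hA hB hf) (x + F x) x
      _ ≤ (2 * A + B) * h₀ := by gcongr; exact hF x
      _ ≤ 2 * (A * h₀) + B * L := by linarith [mul_le_mul_of_nonneg_left hh₀ hB]
      _ = _ := by rw [mul_left_comm (L ^ (1 - μ)), hLμ]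
  set S := A * h₀ + B * L ^ μ + A₁ * h₁ with hS
  have hS0 : 0 ≤ S := by positivity
  have hsup' : ∀ x, ‖f (x + F x) - f x‖ ≤ (2 + L ^ (1 - μ)) * S := fun x => (hsup x).trans <| by
    have : L ^ (1 - μ) * (B * L ^ μ) ≤ L ^ (1 - μ) * S := by
      gcongr; linarith
    linarith
  refine ⟨fun x => (hsup' x).trans (mul_le_mul_of_nonneg_right (by linarith) hS0), fun x y => ?_⟩
  rcases le_total 1 ‖x - y‖ with hxy | hxy
  · calc ‖f (x + F x) - f x - (f (y + F y) - f y)‖ ≤ 2 * ((2 + L ^ (1 - μ)) * S) * 1 := by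
          refine (norm_sub_le _ _).trans ?_
          linarith [hsup' x, hsup' y]
      _ ≤ 2 * ((2 + L ^ (1 - μ)) * S) * ‖x - y‖ ^ α := by
        gcongr
        exact Real.one_le_rpow hxy hα.le
      _ = (4 + 2 * L ^ (1 - μ)) * S * ‖x - y‖ ^ α := by ring
      _ ≤ _ := mul_le_mul_of_nonneg_right (mul_le_mul_of_nonneg_right (by linarith) hS0)
        (Real.rpow_nonneg (norm_nonneg _) _)
  rcases eq_or_ne x y with rfl | hne
  · simp [Real.zero_rpow hα.ne']
  have hr : 0 < ‖x - y‖ := norm_pos_iff.2 (sub_ne_zero.2 hne)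
  have hr1 : ‖x - y‖ ≤ ‖x - y‖ ^ α := by
    simpa using Real.rpow_le_rpow_of_exponent_ge hr hxy hα1
  have hlip : A₁ * ‖F x - F y‖ ≤ A₁ * h₁ * ‖x - y‖ ^ α := by
    calc A₁ * ‖F x - F y‖ ≤ A₁ * (h₁ * ‖x - y‖) := by gcongr; exact hF' x y
      _ ≤ A₁ * (h₁ * ‖x - y‖ ^ α) := by gcongr
      _ = _ := by ring
  have hmain : ‖f (x + F x) - f x - (f (y + F y) - f y)‖ ≤
      (1 + K) * (B * L ^ μ) * ‖x - y‖ ^ α + A₁ * h₁ * ‖x - y‖ ^ α := by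
    rcases le_total L ‖x - y‖ with h | h
    · refine (norm_increment_sub_le (ρ := (1 + K) * ‖x - y‖) (by linarith) hfd hA₁ hB hf x y (F x)
        (F y) fun t ht => ?_).trans (add_le_add ?_ hlip)
      · rw [add_sub_add_comm, ← smul_sub]
        refine (norm_add_le _ _).trans ?_
        rw [norm_smul, Real.norm_of_nonneg ht.1]
        have : t * ‖F x - F y‖ ≤ 1 * (K * ‖x - y‖) :=
          mul_le_mul ht.2 ((hF' x y).trans (by gcongr)) (norm_nonneg _) zero_le_one
        linarith
      · have e : ‖x - y‖ ^ (α + μ - 1) * ‖x - y‖ ^ (1 - μ) = ‖x - y‖ ^ α := by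
          rw [← Real.rpow_add hr]; ring_nf
        calc B * ((1 + K) * ‖x - y‖) ^ (α + μ - 1) * ‖F x‖
            ≤ B * ((1 + K) * ‖x - y‖ ^ (α + μ - 1)) * (‖x - y‖ ^ (1 - μ) * L ^ μ) := by
              rw [Real.mul_rpow (by linarith) hr.le]
              gcongr
              · simpa using Real.rpow_le_rpow_of_exponent_le (by linarith : 1 ≤ 1 + K)
                  (by linarith : α + μ - 1 ≤ 1)
              · refine ((hF x).trans hh₀).trans ?_
                nth_rewrite 1 [← hLμ]
                gcongr
          _ = (1 + K) * (B * L ^ μ) * (‖x - y‖ ^ (α + μ - 1) * ‖x - y‖ ^ (1 - μ)) := by ring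
          _ = _ := by rw [e]
    · have hinc := norm_increment_sub_le (ρ := L) (by linarith) hfd hA₁ hB hf y (y + F y) (x - y)
        (x + F x - (y + F y)) fun t ht => by
          have e : y + t • (x - y) - (y + F y + t • (x + F x - (y + F y))) =
              -((1 - t) • F y + t • F x) := by module
          rw [e, norm_neg]
          refine (norm_add_le _ _).trans ?_
          rw [norm_smul, norm_smul, Real.norm_of_nonneg ht.1,
            Real.norm_of_nonneg (sub_nonneg.2 ht.2)]
          have h1 := mul_le_mul_of_nonneg_left ((hF x).trans hh₀) ht.1
          have h2 := mul_le_mul_of_nonneg_left ((hF y).trans hh₀) (sub_nonneg.2 ht.2)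
          linarith
      rw [add_sub_cancel, add_sub_cancel, show x - y - (x + F x - (y + F y)) = -(F x - F y) by abel,
        norm_neg] at hinc
      rw [show f (x + F x) - f x - (f (y + F y) - f y) =
        -(f x - f y - (f (x + F x) - f (y + F y))) by abel, norm_neg]
      refine hinc.trans (add_le_add ?_ hlip)
      have e : L ^ (α + μ - 1) * L ^ (1 - α) = L ^ μ := by
        rw [← Real.rpow_add' hL (by ring_nf; exact hμ.ne')]; ring_nf
      have e' : ‖x - y‖ = ‖x - y‖ ^ α * ‖x - y‖ ^ (1 - α) := by
        rw [← Real.rpow_add hr]; simp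
      calc B * L ^ (α + μ - 1) * ‖x - y‖
          = B * L ^ (α + μ - 1) * (‖x - y‖ ^ α * ‖x - y‖ ^ (1 - α)) := by rw [← e']
        _ ≤ B * L ^ (α + μ - 1) * (‖x - y‖ ^ α * L ^ (1 - α)) := by
          gcongr
        _ = 1 * (B * (L ^ (α + μ - 1) * L ^ (1 - α))) * ‖x - y‖ ^ α := by ring
        _ ≤ (1 + K) * (B * L ^ μ) * ‖x - y‖ ^ α := by rw [e]; gcongr; linarith
  refine hmain.trans ?_
  have h1 : (1 + K) * (B * L ^ μ) + A₁ * h₁ ≤ (4 + 2 * L ^ (1 - μ) + K + 1) * S := by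
    have h2 : (1 + K) * (B * L ^ μ) ≤ (1 + K) * S := by gcongr; linarith
    have h3 : A₁ * h₁ ≤ S := by linarith
    have h4 : 0 ≤ 2 * L ^ (1 - μ) * S := by positivity
    linarith
  have := mul_le_mul_of_nonneg_right h1 (Real.rpow_nonneg (norm_nonneg (x - y)) α)
  linarith

end TopOrder

section PartialDerivatives

variable {d : ℕ} {V : Type} [NormedAddCommGroup V] [NormedSpace ℝ V] {f : Euc d → V}

lemma contDiff_pder {n : ℕ} (i : Fin d) (hf : ContDiff ℝ (n + 1 : ℕ) f) :
    ContDiff ℝ n (pder i f) :=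
  (hf.fderiv_right (by norm_cast)).clm_apply contDiff_const

lemma contDiff_pderPow {n : ℕ} (i : Fin d) (k : ℕ) (hf : ContDiff ℝ (n + k : ℕ) f) :
    ContDiff ℝ n (pderPow i k f) := by
  induction k generalizing n with
  | zero => exact hf
  | succ k ih => exact contDiff_pder i (ih (by convert hf using 2; ring))

lemma contDiff_foldr_pderPow {n : ℕ} (γ : Fin d → ℕ) (l : List (Fin d))
    (hf : ContDiff ℝ (n + (l.map γ).sum : ℕ) f) :
    ContDiff ℝ n (l.foldr (fun i g => pderPow i (γ i) g) f) := by
  induction l generalizing n with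
  | nil => simpa using hf
  | cons j l ih =>
    refine contDiff_pderPow j (γ j) (ih ?_)
    convert hf using 2
    simp [add_assoc]

lemma contDiff_mder {n : ℕ} (γ : Fin d → ℕ) (hf : ContDiff ℝ (n + ∑ i, γ i : ℕ) f) :
    ContDiff ℝ n (mder γ f) :=
  contDiff_foldr_pderPow γ _ (by rwa [← Fin.sum_univ_def])

lemma pder_comm (i j : Fin d) (hf : ContDiff ℝ 2 f) :
    pder i (pder j f) = pder j (pder i f) := by
  have hd : Differentiable ℝ (fderiv ℝ f) :=
    (hf.fderiv_right (m := 1) (by norm_num)).differentiable (by norm_num)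
  have key : ∀ (i j : Fin d) (x : Euc d), pder i (pder j f) x =
      fderiv ℝ (fderiv ℝ f) x (EuclideanSpace.single i 1) (EuclideanSpace.single j 1) := by
    intro i j x
    have h := (hd x).hasFDerivAt.clm_apply
      (hasFDerivAt_const (EuclideanSpace.single j (1 : ℝ)) x)
    unfold pder
    rw [h.fderiv]
    simp
  funext x
  rw [key, key]
  exact (hf.contDiffAt.isSymmSndFDerivAt (by simp)).eq _ _

lemma pder_pderPow_comm (i j : Fin d) (k : ℕ) (hf : ContDiff ℝ (k + 1 : ℕ) f) :
    pder i (pderPow j k f) = pderPow j k (pder i f) := by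
  induction k with
  | zero => rfl
  | succ k ih =>
    have h : ContDiff ℝ (2 : ℕ) (pderPow j k f) :=
      contDiff_pderPow j k (by convert hf using 2; ring)
    change pder i (pder j (pderPow j k f)) = pder j (pderPow j k (pder i f))
    rw [pder_comm i j (mod_cast h), ih (hf.of_le (by norm_cast; omega))]

lemma pder_foldr_pderPow (i : Fin d) (γ : Fin d → ℕ) (l : List (Fin d)) (hl : l.Nodup) (hi : i ∈ l)
    (hf : ContDiff ℝ ((l.map γ).sum + 1 : ℕ) f) :
    pder i (l.foldr (fun j g => pderPow j (γ j) g) f) =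
      l.foldr (fun j g => pderPow j ((γ + Pi.single i 1 : Fin d → ℕ) j) g) f := by
  induction l with
  | nil => simp at hi
  | cons j l ih =>
    obtain ⟨hjl, hl'⟩ := List.nodup_cons.1 hl
    simp only [List.map_cons, List.sum_cons] at hf
    simp only [List.foldr_cons]
    rcases eq_or_ne i j with rfl | hij
    · have e : l.foldr (fun j g => pderPow j ((γ + Pi.single i 1 : Fin d → ℕ) j) g) f =
          l.foldr (fun j g => pderPow j (γ j) g) f :=
        List.foldr_ext _ _ _ fun a ha b => by
          have : a ≠ i := fun h => hjl (h ▸ ha)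
          simp [this]
      rw [e]
      simp [pderPow]
    · rw [pder_pderPow_comm i j, ih hl' ((List.mem_cons.1 hi).resolve_left hij)
        (hf.of_le (by norm_cast; omega))]
      · simp [hij.symm]
      · refine contDiff_foldr_pderPow γ l (by convert hf using 2; ring)

lemma pder_mder (i : Fin d) (γ : Fin d → ℕ) (hf : ContDiff ℝ ((∑ j, γ j) + 1 : ℕ) f) :
    pder i (mder γ f) = mder (γ + Pi.single i 1) f :=
  pder_foldr_pderPow i γ _ (List.nodup_finRange d) (List.mem_finRange i)
    (by rwa [← Fin.sum_univ_def])

@[simp]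
lemma mder_zero (f : Euc d → V) : mder 0 f = f := by
  simp [mder, pderPow]

/-- The linear map from the `i`-th partial derivative to its contribution to the differential. -/
def coordSmul (i : Fin d) (V : Type) [NormedAddCommGroup V] [NormedSpace ℝ V] :
    V →L[ℝ] Euc d →L[ℝ] V :=
  ContinuousLinearMap.smulRightL ℝ (Euc d) V (EuclideanSpace.proj i)

lemma norm_coordSmul_le (i : Fin d) : ‖coordSmul i V‖ ≤ 1 := by
  refine ContinuousLinearMap.opNorm_le_bound _ zero_le_one fun v => ?_
  refine ContinuousLinearMap.opNorm_le_bound _ (by positivity) fun x => ?_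
  change ‖x i • v‖ ≤ _
  rw [norm_smul, one_mul, mul_comm]
  gcongr
  exact PiLp.norm_apply_le x i

lemma fderiv_eq_sum_pder (x : Euc d) :
    fderiv ℝ f x = ∑ i, coordSmul i V (pder i f x) := by
  ext v
  nth_rewrite 1 [← (EuclideanSpace.basisFun (Fin d) ℝ).sum_repr v]
  simp [coordSmul, pder]

lemma HolderBdd.succ_of_pder {α A : ℝ} {k : ℕ} (hf : Differentiable ℝ f) (hA : ∀ x, ‖f x‖ ≤ A)
    (h : ∀ i, HolderBdd α A k (pder i f)) : HolderBdd α ((d + 1) * A) (k + 1) f := by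
  have hA0 : 0 ≤ A := (norm_nonneg _).trans (hA 0)
  refine ⟨fun x => (hA x).trans (le_mul_of_one_le_left hA0 (by simp)), hf, ?_⟩
  rw [show fderiv ℝ f = fun x => ∑ i, coordSmul i V (pder i f x) from funext fderiv_eq_sum_pder]
  refine (HolderBdd.sum Finset.univ (A := 1 * A) fun i _ =>
    (h i).clm (coordSmul i V) (norm_coordSmul_le i)).mono ?_
  simp only [Finset.card_univ, Fintype.card_fin]
  linarith

lemma HolderBdd.pder {α A : ℝ} {k : ℕ} (hf : HolderBdd α A (k + 1) f) (i : Fin d) :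
    HolderBdd α A k (pder i f) := by
  refine (hf.2.2.clm (ContinuousLinearMap.apply ℝ V (EuclideanSpace.single i (1 : ℝ))) (c := 1)
    (ContinuousLinearMap.opNorm_le_bound _ zero_le_one fun L => ?_)).mono (by simp)
  simpa using L.le_opNorm (EuclideanSpace.single i (1 : ℝ))

lemma HolderBdd.pderPow {α A : ℝ} {k n : ℕ} (hf : HolderBdd α A (k + n) f) (i : Fin d) :
    HolderBdd α A k (pderPow i n f) := by
  induction n generalizing k with
  | zero => exact hf
  | succ n ih => exact (ih (k := k + 1) (by convert hf using 1; ring)).pder i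

lemma HolderBdd.foldr_pderPow {α A : ℝ} {k : ℕ} (γ : Fin d → ℕ) (l : List (Fin d))
    (hf : HolderBdd α A (k + (l.map γ).sum) f) :
    HolderBdd α A k (l.foldr (fun i g => _root_.pderPow i (γ i) g) f) := by
  induction l generalizing k with
  | nil => simpa using hf
  | cons j l ih =>
    refine (ih (k := k + γ j) ?_).pderPow j
    convert hf using 1
    simp [add_assoc]

lemma HolderBdd.mder {α A : ℝ} {k : ℕ} {γ : Fin d → ℕ}
    (hf : HolderBdd α A (k + ∑ i, γ i) f) : HolderBdd α A k (mder γ f) :=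
  HolderBdd.foldr_pderPow γ _ (by rwa [← Fin.sum_univ_def])

/-- A function whose partial derivatives satisfy the Hölder bounds has a bounded Hölder
structure. -/
lemma holderBdd_mder_of_bounds {α A : ℝ} {m : ℕ} (hf : ContDiff ℝ m f)
    (hsup : ∀ γ : Fin d → ℕ, ∑ i, γ i ≤ m → ∀ x, ‖mder γ f x‖ ≤ A)
    (hhol : ∀ γ : Fin d → ℕ, ∑ i, γ i = m → ∀ x y, ‖mder γ f x - mder γ f y‖ ≤ A * ‖x - y‖ ^ α)
    (k : ℕ) (γ : Fin d → ℕ) (hγ : ∑ i, γ i + k = m) :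
    HolderBdd α ((d + 1) ^ k * A) k (mder γ f) := by
  have hA0 : 0 ≤ A := (norm_nonneg _).trans (hsup 0 (by simp) 0)
  induction k generalizing γ with
  | zero => exact ⟨by simpa using hsup γ (by omega), by simpa using hhol γ (by omega)⟩
  | succ k ih =>
    rw [pow_succ', mul_assoc]
    have h1 : (1 : ℝ) ≤ (d + 1) ^ k := one_le_pow₀ (by simp)
    refine HolderBdd.succ_of_pder ?_ (fun x => (hsup γ (by omega) x).trans
      (le_mul_of_one_le_left hA0 h1)) fun i => ?_
    · exact (contDiff_mder (n := 1) γ (hf.of_le (by norm_cast; omega))).differentiable (by simp)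
    · rw [pder_mder i γ (hf.of_le (by norm_cast; omega))]
      exact ih _ (by simp [Finset.sum_add_distrib]; omega)

end PartialDerivatives

section Norms

variable {d : ℕ} {V : Type} [NormedAddCommGroup V] [NormedSpace ℝ V] {f : Euc d → V}

lemma nrm0_le_ofReal {V : Type*} [NormedAddCommGroup V] {f : Euc d → V} {A : ℝ}
    (hf : ∀ x, ‖f x‖ ≤ A) : nrm0 f ≤ ENNReal.ofReal A :=
  iSup_le fun x => by
    rw [← enorm_eq_nnnorm, ← ofReal_norm]
    exact ENNReal.ofReal_le_ofReal (hf x)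

lemma norm_le_toReal_nrm0 {V : Type*} [NormedAddCommGroup V] {f : Euc d → V} (hf : nrm0 f ≠ ⊤)
    (x : Euc d) : ‖f x‖ ≤ (nrm0 f).toReal := by
  have h := ENNReal.toReal_mono hf (le_iSup (fun x => (‖f x‖₊ : ℝ≥0∞)) x)
  simpa using h

lemma hsemi_le_ofReal {V : Type*} [NormedAddCommGroup V] {f : Euc d → V} {A α : ℝ} (hA : 0 ≤ A)
    (hf : ∀ x y, ‖f x - f y‖ ≤ A * ‖x - y‖ ^ α) : hsemi α f ≤ ENNReal.ofReal A := by
  refine iSup_le fun x => iSup_le fun y => iSup_le fun hxy => ?_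
  refine ENNReal.div_le_of_le_mul ?_
  rw [← enorm_eq_nnnorm, ← ofReal_norm, ← ENNReal.ofReal_mul hA]
  exact ENNReal.ofReal_le_ofReal (hf x y)

lemma norm_sub_le_toReal_hsemi {V : Type*} [NormedAddCommGroup V] {f : Euc d → V} {α : ℝ}
    (hf : hsemi α f ≠ ⊤) (x y : Euc d) : ‖f x - f y‖ ≤ (hsemi α f).toReal * ‖x - y‖ ^ α := by
  rcases eq_or_ne x y with rfl | hxy
  · simp only [sub_self, norm_zero]
    positivity
  have hr : 0 < ‖x - y‖ ^ α := Real.rpow_pos_of_pos (norm_pos_iff.2 (sub_ne_zero.2 hxy)) α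
  have h1 : (‖f x - f y‖₊ : ℝ≥0∞) / ENNReal.ofReal (‖x - y‖ ^ α) ≤ hsemi α f :=
    le_iSup_of_le x (le_iSup_of_le y (le_iSup_of_le hxy le_rfl))
  have h2 := ENNReal.toReal_mono hf h1
  rw [ENNReal.toReal_div, ENNReal.toReal_ofReal hr.le] at h2
  simpa using (div_le_iff₀ hr).1 h2

lemma nrm0_le_holNorm {β : ℝ} {γ : Fin d → ℕ} (hγ : ∑ i, γ i ≤ ifl β) :
    nrm0 (mder γ f) ≤ holNorm β f :=
  (ENNReal.le_tsum (f := fun γ : {γ : Fin d → ℕ // (∑ i, γ i) ≤ ifl β} => nrm0 (mder γ.1 f))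
    ⟨γ, hγ⟩).trans le_self_add

lemma hsemi_le_holNorm {β : ℝ} {γ : Fin d → ℕ} (hγ : ∑ i, γ i = ifl β) :
    hsemi (frc β) (mder γ f) ≤ holNorm β f :=
  (ENNReal.le_tsum (f := fun γ : {γ : Fin d → ℕ // (∑ i, γ i) = ifl β} =>
    hsemi (frc β) (mder γ.1 f)) ⟨γ, hγ⟩).trans le_add_self

lemma holderBdd_mder_of_holNorm {β : ℝ} (hf : ContDiff ℝ (ifl β) f) (h : holNorm β f ≠ ⊤) {k : ℕ}
    {γ : Fin d → ℕ} (hγ : ∑ i, γ i + k = ifl β) :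
    HolderBdd (frc β) ((d + 1) ^ k * (holNorm β f).toReal) k (mder γ f) := by
  refine holderBdd_mder_of_bounds hf (fun γ hγ x => ?_) (fun γ hγ x y => ?_) k γ hγ
  · have h1 := nrm0_le_holNorm (f := f) hγ
    exact (norm_le_toReal_nrm0 (ne_top_of_le_ne_top h h1) x).trans (ENNReal.toReal_mono h h1)
  · have h1 := hsemi_le_holNorm (f := f) hγ
    refine (norm_sub_le_toReal_hsemi (ne_top_of_le_ne_top h h1) x y).trans ?_
    gcongr

lemma holderBdd_of_holNorm {β : ℝ} (hf : ContDiff ℝ (ifl β) f) (h : holNorm β f ≠ ⊤) :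
    HolderBdd (frc β) ((d + 1) ^ ifl β * (holNorm β f).toReal) (ifl β) f := by
  simpa using holderBdd_mder_of_holNorm (γ := 0) hf h (by simp)

instance finite_multiIndex_le (d n : ℕ) : Finite {γ : Fin d → ℕ // ∑ i, γ i ≤ n} :=
  Finite.of_injective (β := Fin d → Fin (n + 1))
    (fun γ i => ⟨γ.1 i, Nat.lt_succ_of_le
      ((Finset.single_le_sum (fun _ _ => Nat.zero_le _) (Finset.mem_univ i)).trans γ.2)⟩)
    fun γ γ' h => Subtype.ext <| funext fun i => by simpa using congrFun h i

instance finite_multiIndex_eq (d n : ℕ) : Finite {γ : Fin d → ℕ // ∑ i, γ i = n} :=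
  Finite.of_injective (β := {γ : Fin d → ℕ // ∑ i, γ i ≤ n}) (fun γ => ⟨γ.1, γ.2.le⟩)
    fun γ γ' h => Subtype.ext (by simpa using h)

lemma tsum_le_card_mul {ι : Type*} [Finite ι] {u : ι → ℝ≥0∞} {A : ℝ}
    (hu : ∀ i, u i ≤ ENNReal.ofReal A) : ∑' i, u i ≤ ENNReal.ofReal (Nat.card ι * A) := by
  have := Fintype.ofFinite ι
  rw [tsum_fintype, ENNReal.ofReal_mul (by positivity), ENNReal.ofReal_natCast,
    Nat.card_eq_fintype_card, ← Finset.card_univ, ← nsmul_eq_mul]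
  exact Finset.sum_le_card_nsmul _ _ _ fun i _ => hu i

lemma holNorm_le_of_holderBdd (d : ℕ) (β : ℝ) :
    ∃ C : ℝ, 0 ≤ C ∧ ∀ {V : Type} [NormedAddCommGroup V] [NormedSpace ℝ V] {f : Euc d → V} {A : ℝ},
      HolderBdd (frc β) A (ifl β) f → holNorm β f ≤ ENNReal.ofReal (C * A) := by
  refine ⟨Nat.card {γ : Fin d → ℕ // ∑ i, γ i ≤ ifl β} +
    Nat.card {γ : Fin d → ℕ // ∑ i, γ i = ifl β}, by positivity, fun {V _ _ f A} hf => ?_⟩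
  have hA := hf.nonneg
  rw [add_mul, ENNReal.ofReal_add (by positivity) (by positivity)]
  refine add_le_add (tsum_le_card_mul fun γ => nrm0_le_ofReal ?_)
    (tsum_le_card_mul fun γ => hsemi_le_ofReal hA ?_)
  · exact (HolderBdd.mder (γ := γ.1) (k := ifl β - ∑ i, γ.1 i)
      (by rwa [Nat.sub_add_cancel γ.2])).norm_le
  · exact (HolderBdd.mder (γ := γ.1) (k := 0) (by rwa [zero_add, γ.2])).2

end Norms

section Exponents

variable {β μ : ℝ}

lemma ifl_add_frc (β : ℝ) : (ifl β : ℝ) + frc β = β := by simp [frc]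

lemma frc_pos (hβ : 0 < β) : 0 < frc β := by
  have h := Nat.ceil_lt_add_one hβ.le
  have h1 : 1 ≤ ⌈β⌉₊ := Nat.one_le_ceil_iff.2 hβ
  rw [frc, ifl, Nat.cast_sub h1, Nat.cast_one]
  linarith

lemma frc_le_one (β : ℝ) : frc β ≤ 1 := by
  have h := Nat.le_ceil β
  rcases Nat.eq_zero_or_pos ⌈β⌉₊ with h0 | h1
  · rw [h0] at h
    simp only [frc, ifl, h0]
    norm_num at h ⊢
    linarith
  · rw [frc, ifl, Nat.cast_sub h1, Nat.cast_one]
    linarith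

lemma ifl_eq_of_mem {n : ℕ} (h : (n : ℝ) < β) (h' : β ≤ n + 1) : ifl β = n := by
  have : ⌈β⌉₊ = n + 1 := by
    rw [Nat.ceil_eq_iff (by omega)]
    push_cast
    simpa using ⟨h, h'⟩
  simp [ifl, this]

lemma ifl_add_of_le (hβ : 0 < β) (hμ : 0 < μ) (h : frc β + μ ≤ 1) : ifl (β + μ) = ifl β :=
  ifl_eq_of_mem (by linarith [ifl_add_frc β, frc_pos hβ]) (by linarith [ifl_add_frc β])

lemma ifl_add_of_lt (hμ : μ ≤ 1) (h : 1 < frc β + μ) : ifl (β + μ) = ifl β + 1 :=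
  ifl_eq_of_mem (by push_cast; linarith [ifl_add_frc β])
    (by push_cast; linarith [ifl_add_frc β, frc_le_one β])

lemma ifl_eq_zero (hβ : 0 < β) (h : β ≤ 1) : ifl β = 0 :=
  ifl_eq_of_mem (by simpa using hβ) (by simpa using h)

lemma ifl_eq_succ (h : 1 < β) : ifl β = ifl (β - 1) + 1 :=
  ifl_eq_of_mem (by push_cast; linarith [ifl_add_frc (β - 1), frc_pos (sub_pos.2 h)])
    (by push_cast; linarith [ifl_add_frc (β - 1), frc_le_one (β - 1)])

lemma frc_sub_one (h : 1 < β) : frc (β - 1) = frc β := by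
  rw [frc, frc, ifl_eq_succ h]
  push_cast
  ring

end Exponents

section WeightedComposition

/-- Regularity of `∂^γ f (x + F x) - ∂^γ f x` from that of the top-order terms. -/
lemma holderBdd_mder_comp_sub (d : ℕ) {α K : ℝ} (hα : 0 < α) (hα1 : α ≤ 1) (hK : 0 ≤ K) (m k : ℕ) :
    ∃ C : ℝ, 1 ≤ C ∧ ∀ {f : Euc d → ℝ} {F : Euc d → Euc d} {A h R : ℝ}, ContDiff ℝ m f →
      (∀ (k : ℕ) (γ : Fin d → ℕ), ∑ i, γ i + k = m → HolderBdd α A k (mder γ f)) → h ≤ K →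
      NearId α h m F → 0 ≤ R →
      (∀ γ : Fin d → ℕ, ∑ i, γ i = m →
        HolderBdd α R 0 (fun x => mder γ f (x + F x) - mder γ f x)) →
      ∀ γ : Fin d → ℕ, ∑ i, γ i + k = m →
        HolderBdd α (C * (A * h + R)) k (fun x => mder γ f (x + F x) - mder γ f x) := by
  induction k with
  | zero =>
    refine ⟨1, le_rfl, fun {f F A h R} _ hA _ hF _ hR γ hγ => (hR γ hγ).mono ?_⟩
    have := mul_nonneg (hA 0 γ hγ).nonneg hF.nonneg
    linarith
  | succ k ih =>
    obtain ⟨C₁, hC₁, hind⟩ := ih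
    obtain ⟨C₂, hC₂, hcomp⟩ := NearId.comp (E := Euc d) hα hα1 k hK
    refine ⟨1 + d * C₁ + 2 * 4 ^ k * C₂, ?_, fun {f F A h R} hf hA hh hF hR0 hR γ hγ => ?_⟩
    · have : 0 ≤ d * C₁ + 2 * 4 ^ k * C₂ := by positivity
      linarith
    have hg := hA _ γ hγ
    have hd := hF.hasFDerivAt_comp_sub hg.2.1
    have hAh : 0 ≤ A * h := mul_nonneg hg.nonneg hF.nonneg
    have hS : 0 ≤ A * h + R := by linarith
    have hC₁S : 0 ≤ d * C₁ * (A * h + R) := by positivity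
    have hC₂S : 0 ≤ 2 * 4 ^ k * C₂ * (A * h) := by positivity
    have hC₂R : 0 ≤ 2 * 4 ^ k * C₂ * R := by positivity
    refine ⟨fun x => (hF.norm_comp_sub_le hg.2.1 hg.2.2.norm_le x).trans (by linarith),
      fun x => (hd x).differentiableAt, ?_⟩
    rw [show fderiv ℝ (fun x => mder γ f (x + F x) - mder γ f x) = _ from
      funext fun x => (hd x).fderiv]
    have hsum : HolderBdd α (d * C₁ * (A * h + R)) k
        (fun x => fderiv ℝ (mder γ f) (x + F x) - fderiv ℝ (mder γ f) x) := by
      have e : (fun x => fderiv ℝ (mder γ f) (x + F x) - fderiv ℝ (mder γ f) x) = fun x =>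
          ∑ i, coordSmul i ℝ (mder (γ + Pi.single i 1) f (x + F x) -
            mder (γ + Pi.single i 1) f x) := by
        funext x
        have hc : ContDiff ℝ (∑ i, γ i + 1 : ℕ) f := hf.of_le (by norm_cast; omega)
        simp only [map_sub, Finset.sum_sub_distrib, ← pder_mder _ γ hc, ← fderiv_eq_sum_pder]
      rw [e]
      refine (HolderBdd.sum Finset.univ (A := 1 * (C₁ * (A * h + R))) fun i _ =>
        (hind hf hA hh hF hR0 hR (γ + Pi.single i 1) ?_).clm (coordSmul i ℝ)
          (norm_coordSmul_le i)).mono (le_of_eq ?_)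
      · simp [Finset.sum_add_distrib]
        omega
      · simp only [Finset.card_univ, Fintype.card_fin]
        ring
    have hprod := (hcomp hg.2.2 hh (hF.of_le (by omega))).bilin hα hα1 (hF.holder k (by omega))
      (ContinuousLinearMap.compL ℝ (Euc d) (Euc d) ℝ) (ContinuousLinearMap.norm_compL_le _ _ _ _)
    refine (hsum.add hprod).mono ?_
    linarith

/-- Regularity of a weighted composition difference from that of the top-order terms. -/
lemma holderBdd_weighted_comp_sub (d : ℕ) {α θ K : ℝ} (hα : 0 < α) (hα1 : α ≤ 1) (hθ : 0 ≤ θ)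
    (hK : 0 ≤ K) (m : ℕ) :
    ∃ C : ℝ, 0 ≤ C ∧ ∀ {φ ψ : Euc d → ℝ} {F : Euc d → Euc d} {A h R : ℝ},
      (∀ x, ψ x = r1 x ^ (-θ) * φ x) → ContDiff ℝ m ψ →
      (∀ (k : ℕ) (γ : Fin d → ℕ), ∑ i, γ i + k = m → HolderBdd α A k (mder γ ψ)) → h ≤ K →
      NearId α h m F → 0 ≤ R →
      (∀ γ : Fin d → ℕ, ∑ i, γ i = m →
        HolderBdd α R 0 (fun x => mder γ ψ (x + F x) - mder γ ψ x)) →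
      HolderBdd α (C * (A * h + R)) m (fun x => r1 x ^ (-θ) * (φ (x + F x) - φ x)) := by
  obtain ⟨C₁, hC₁, hsub⟩ := holderBdd_mder_comp_sub d hα hα1 hK m m
  obtain ⟨C₂, hC₂, hcomp⟩ := NearId.comp (E := Euc d) hα hα1 m hK
  obtain ⟨C₃, hC₃, hratio⟩ := holderBdd_weight_ratio d hα hα1 hθ hK m
  refine ⟨C₁ + 2 * 4 ^ m * C₃ * C₂, by positivity,
    fun {φ ψ F A h R} hψ hψc hA hh hF hR0 hR => ?_⟩
  have h1 := hsub hψc hA hh hF hR0 hR 0 (by simp)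
  have h2 := hA m 0 (by simp)
  simp only [mder_zero] at h1 h2
  have h3 := (hratio F h hh hF).bilin hα hα1 (hcomp h2 hh hF) (ContinuousLinearMap.mul ℝ ℝ)
    (ContinuousLinearMap.opNorm_mul_le ℝ ℝ)
  have e : (fun x => r1 x ^ (-θ) * (φ (x + F x) - φ x)) = fun x => (ψ (x + F x) - ψ x) +
      ContinuousLinearMap.mul ℝ ℝ (r1 x ^ (-θ) * r1 (x + F x) ^ θ - 1) (ψ (x + F x)) := by
    funext x
    have hr : r1 (x + F x) ^ θ * r1 (x + F x) ^ (-θ) = 1 := by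
      rw [← Real.rpow_add (r1_pos _)]
      simp
    simp only [hψ, ContinuousLinearMap.mul_apply']
    linear_combination (-(r1 x ^ (-θ) * φ (x + F x))) * hr
  rw [e]
  have hC : 0 ≤ 2 * 4 ^ m * C₃ * C₂ * R := by positivity
  exact (h1.add h3).mono (by linarith)

end WeightedComposition

section Displacement

variable {d : ℕ} {H Hi : Euc d → Euc d}

lemma nrm0_le_ite_holNorm {V : Type} [NormedAddCommGroup V] [NormedSpace ℝ V] (f : Euc d → V)
    (β : ℝ) : nrm0 f ≤ if β ≤ 1 then nrm0 f else holNorm (β - 1) f := by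
  split_ifs
  · exact le_rfl
  · simpa using nrm0_le_holNorm (f := f) (β := β - 1) (γ := 0) (by simp)

lemma nearId_of_norms (d : ℕ) {β : ℝ} (hβ : 0 < β) :
    ∃ C : ℝ, 1 ≤ C ∧ ∀ (H : Euc d → Euc d) (a b : ℝ),
      ContDiff ℝ (1 + ifl (max β 1 - 1) : ℕ) H →
      nrm0 H ≤ ENNReal.ofReal a → 0 ≤ a → 0 ≤ b →
      (if β ≤ 1 then nrm0 (fun x => fderiv ℝ H x)
          else holNorm (β - 1) (fun x => fderiv ℝ H x)) ≤ ENNReal.ofReal b →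
      NearId (frc β) (C * (a + b)) (ifl β) H := by
  set C : ℝ := 2 ^ ifl β * (d + 1) ^ ifl β with hC
  have hC1 : 1 ≤ C := one_le_mul_of_one_le_of_one_le (one_le_pow₀ (by norm_num))
    (one_le_pow₀ (by simp))
  refine ⟨C, hC1, fun H a b hH ha ha0 hb0 hb => ?_⟩
  have hab : a + b ≤ C * (a + b) := le_mul_of_one_le_left (by linarith) hC1
  have hb' := (nrm0_le_ite_holNorm (fun x => fderiv ℝ H x) β).trans hb
  refine ⟨hH.differentiable (by norm_cast; omega), fun x => ?_, fun x => ?_, fun j hj => ?_⟩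
  · have := norm_le_toReal_nrm0 (ne_top_of_le_ne_top ENNReal.ofReal_ne_top ha) x
    have := ENNReal.toReal_le_of_le_ofReal ha0 ha
    linarith
  · have := norm_le_toReal_nrm0 (ne_top_of_le_ne_top ENNReal.ofReal_ne_top hb') x
    have := ENNReal.toReal_le_of_le_ofReal hb0 hb'
    linarith
  · have hβ1 : 1 < β := by
      by_contra! h
      simp [ifl_eq_zero hβ h] at hj
    have hn := ifl_eq_succ hβ1
    rw [if_neg hβ1.not_ge] at hb
    rw [max_eq_left hβ1.le] at hH
    have h := holderBdd_of_holNorm (f := fun x => fderiv ℝ H x) (β := β - 1)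
      (hH.fderiv_right (by norm_cast; omega)) (ne_top_of_le_ne_top ENNReal.ofReal_ne_top hb)
    rw [frc_sub_one hβ1] at h
    refine (h.order_le (m := j) (frc_pos hβ) (frc_le_one β) (by omega)).mono ?_
    calc (2 : ℝ) ^ (ifl (β - 1) - j) * ((d + 1) ^ ifl (β - 1) *
          (holNorm (β - 1) fun x => fderiv ℝ H x).toReal)
        ≤ 2 ^ ifl β * ((d + 1) ^ ifl β * (a + b)) := by
          gcongr
          · norm_num
          · omega
          · simp
          · omega
          · linarith [ENNReal.toReal_le_of_le_ofReal hb0 hb]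
      _ = C * (a + b) := by rw [hC, mul_assoc]

/-- Lipschitz bound for the displacement of the inverse map. -/
lemma norm_inverse_sub_sub_le {κ a : ℝ} (hH : ContDiff ℝ 1 H)
    (hB : ∀ x, ∃ B : Euc d →L[ℝ] Euc d,
      (1 + fderiv ℝ H x) * B = 1 ∧ B * (1 + fderiv ℝ H x) = 1 ∧ ‖B‖ ≤ κ)
    (hl : Function.LeftInverse Hi (fun x => x + H x))
    (hr : Function.RightInverse Hi (fun x => x + H x)) (ha : ∀ x, ‖fderiv ℝ H x‖ ≤ a)
    (x y : Euc d) : ‖Hi x - x - (Hi y - y)‖ ≤ κ * a * ‖x - y‖ := by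
  have hd : ∀ y, ∃ D : Euc d →L[ℝ] Euc d, HasFDerivAt (fun x => Hi x - x) D y ∧ ‖D‖ ≤ κ * a := by
    intro y
    obtain ⟨B, h1, h2, h3⟩ := hB (Hi y)
    refine ⟨B - 1, (hasFDerivAt_of_leftInverse hH hl hr y h1 h2).sub (hasFDerivAt_id y), ?_⟩
    have e : B - 1 = -(fderiv ℝ H (Hi y) * B) := by
      rw [← h1]
      noncomm_ring
    rw [e, norm_neg, mul_comm κ]
    exact (norm_mul_le _ _).trans
      (mul_le_mul (ha _) h3 (norm_nonneg _) ((norm_nonneg _).trans (ha 0)))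
  choose D hD hDκ using hd
  exact norm_sub_le_of_fderiv_le (fun x => (hD x).differentiableAt)
    (fun x => (hD x).fderiv ▸ hDκ x) x y

end Displacement

section Main

/-- Finiteness of a lower-order Hölder norm. -/
lemma holNorm_ne_top_of_add {d : ℕ} {β μ : ℝ} (hβ : 0 < β) (hμ : 0 < μ) (hμ1 : μ ≤ 1)
    {f : Euc d → ℝ} (hf : ContDiff ℝ (ifl (β + μ)) f) (h : holNorm (β + μ) f ≠ ⊤) :
    holNorm β f ≠ ⊤ := by
  obtain ⟨C, -, hC⟩ := holNorm_le_of_holderBdd d β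
  have h1 := holderBdd_of_holNorm hf h
  rcases le_or_gt (frc β + μ) 1 with hσ | hσ
  · have e := ifl_add_of_le hβ hμ hσ
    rw [frc, e] at h1
    exact ne_top_of_le_ne_top ENNReal.ofReal_ne_top
      (hC (h1.exponent_le (frc_pos hβ) (by rw [frc]; linarith)))
  · rw [ifl_add_of_lt hμ1 hσ] at h1
    exact ne_top_of_le_ne_top ENNReal.ofReal_ne_top
      (hC (h1.order_pred (frc_pos hβ) (frc_le_one β)))

/-- The weighted estimate, with the top-order terms as a hypothesis. -/
lemma holNorm_weighted_comp_sub_le (d : ℕ) {β κ L₄ L₅ θ c : ℝ} (hβ : 0 < β)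
    (hL₄ : 0 ≤ L₄) (hL₅ : 0 ≤ L₅) (hθ : 0 ≤ θ) (hc : 0 ≤ c) :
    ∃ C : ℝ, 0 ≤ C ∧ ∀ (H Hi : Euc d → Euc d) (φ : Euc d → ℝ) (S : ℝ≥0∞) (T : ℝ),
      ContDiff ℝ (1 + ifl (max β 1 - 1) : ℕ) H →
      (∀ x, ∃ B : Euc d →L[ℝ] Euc d,
        (1 + fderiv ℝ H x) * B = 1 ∧ B * (1 + fderiv ℝ H x) = 1 ∧ ‖B‖ ≤ κ) →
      Function.LeftInverse Hi (fun x => x + H x) →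
      Function.RightInverse Hi (fun x => x + H x) →
      nrm0 H ≤ ENNReal.ofReal L₄ →
      (if β ≤ 1 then nrm0 (fun x => fderiv ℝ H x)
        else holNorm (β - 1) (fun x => fderiv ℝ H x)) ≤ ENNReal.ofReal L₅ →
      S = nrm0 H + (if β ≤ 1 then nrm0 (fun x => fderiv ℝ H x)
        else holNorm (β - 1) (fun x => fderiv ℝ H x)) →
      ContDiff ℝ (ifl β) (fun x => r1 x ^ (-θ) * φ x) →
      holNorm β (fun x => r1 x ^ (-θ) * φ x) ≠ ⊤ → 0 ≤ T →
      (∀ γ : Fin d → ℕ, ∑ i, γ i = ifl β →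
        HolderBdd (frc β)
          (c * ((holNorm β (fun x => r1 x ^ (-θ) * φ x)).toReal * S.toReal + T)) 0
          (fun x => mder γ (fun x => r1 x ^ (-θ) * φ x) (Hi x) -
            mder γ (fun x => r1 x ^ (-θ) * φ x) x)) →
      holNorm β (fun x => r1 x ^ (-θ) * (φ (Hi x) - φ x)) ≤
        ENNReal.ofReal C * holNorm β (fun x => r1 x ^ (-θ) * φ x) * S +
          ENNReal.ofReal C * ENNReal.ofReal T := by
  have hα := frc_pos hβ
  have hα1 := frc_le_one β
  obtain ⟨C₁, hC₁, hnear⟩ := nearId_of_norms d hβ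
  obtain ⟨C₂, hC₂, hinv⟩ := nearId_inverse (E := Euc d) (κ := κ) (K := C₁ * (L₄ + L₅)) hα hα1
    (ifl β)
  obtain ⟨C₃, hC₃, hmain⟩ := holderBdd_weighted_comp_sub d (K := C₂ * (C₁ * (L₄ + L₅))) hα hα1 hθ
    (by positivity) (ifl β)
  obtain ⟨C₄, hC₄, hhol⟩ := holNorm_le_of_holderBdd d β
  refine ⟨C₄ * (C₃ * ((d + 1) ^ ifl β * (C₂ * C₁) + c)), by positivity,
    fun H Hi φ S T hH hB hl hr hH₀ hH₁ hS hψ hP hT hbase => ?_⟩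
  set ψ : Euc d → ℝ := fun x => r1 x ^ (-θ) * φ x with hψdef
  set P := holNorm β ψ with hPdef
  set X := if β ≤ 1 then nrm0 (fun x => fderiv ℝ H x)
    else holNorm (β - 1) (fun x => fderiv ℝ H x) with hX
  have hH₀t := ne_top_of_le_ne_top ENNReal.ofReal_ne_top hH₀
  have hH₁t := ne_top_of_le_ne_top ENNReal.ofReal_ne_top hH₁
  have hSt : S ≠ ⊤ := hS ▸ ENNReal.add_ne_top.2 ⟨hH₀t, hH₁t⟩
  have hSr : S.toReal = (nrm0 H).toReal + X.toReal := by rw [hS, ENNReal.toReal_add hH₀t hH₁t]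
  have hSL : S.toReal ≤ L₄ + L₅ := by
    rw [hSr]
    exact add_le_add (ENNReal.toReal_le_of_le_ofReal hL₄ hH₀)
      (ENNReal.toReal_le_of_le_ofReal hL₅ hH₁)
  have hS0 : 0 ≤ S.toReal := ENNReal.toReal_nonneg
  have hP0 : 0 ≤ P.toReal := ENNReal.toReal_nonneg
  have hnH := hnear H (nrm0 H).toReal X.toReal hH (ENNReal.ofReal_toReal hH₀t).ge
    ENNReal.toReal_nonneg ENNReal.toReal_nonneg (ENNReal.ofReal_toReal hH₁t).ge
  rw [← hSr] at hnH
  have hnF := hinv H Hi _ (by gcongr) (hH.of_le (by norm_cast; omega)) hB hl hr hnH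
  have hA : ∀ (k : ℕ) (γ : Fin d → ℕ), ∑ i, γ i + k = ifl β →
      HolderBdd (frc β) ((d + 1) ^ ifl β * P.toReal) k (mder γ ψ) := fun k γ hγ => by
    refine (holderBdd_mder_of_holNorm hψ hP hγ).mono ?_
    gcongr
    · simp
    · omega
  have h := hhol (hmain (φ := φ) (ψ := ψ) (fun x => rfl) hψ hA (by gcongr) hnF
    (by positivity : 0 ≤ c * (P.toReal * S.toReal + T)) (by simpa using hbase))
  simp only [add_sub_cancel] at h
  refine h.trans ?_
  have e : ENNReal.ofReal (P.toReal * S.toReal + T) = P * S + ENNReal.ofReal T := by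
    rw [ENNReal.ofReal_add (by positivity) hT, ENNReal.ofReal_mul hP0, ENNReal.ofReal_toReal hP,
      ENNReal.ofReal_toReal hSt]
  rw [mul_assoc _ P S, ← mul_add, ← e, ← ENNReal.ofReal_mul (by positivity)]
  refine ENNReal.ofReal_le_ofReal ?_
  have hT' : 0 ≤ C₄ * (C₃ * ((d + 1) ^ ifl β * (C₂ * C₁))) * T := by positivity
  linarith

end Main

/-- weighted Hölder estimate for `φ∘H̃⁻¹ − φ`. -/
theorem stmt_14 (d : ℕ) (hd : 1 ≤ d) (β μ Nκ L₄ L₅ θ : ℝ)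
    (hβ : 0 < β) (hμ : μ ∈ Set.Ioc (0 : ℝ) 1) (hNκ : 0 < Nκ)
    (hL₄ : 0 ≤ L₄) (hL₅ : 0 ≤ L₅) (hθ : 0 ≤ θ) :
    ∃ N : ℝ, 0 < N ∧
      ∀ (H Hi : Euc d → Euc d) (φ : Euc d → ℝ),
        ContDiff ℝ ((1 + ifl (max β 1 - 1) : ℕ) : ℕ) H →
        (∀ x, ∃ B : Euc d →L[ℝ] Euc d,
          (1 + fderiv ℝ H x) * B = 1 ∧ B * (1 + fderiv ℝ H x) = 1 ∧ ‖B‖ ≤ Nκ) →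
        Function.LeftInverse Hi (fun x => x + H x) →
        Function.RightInverse Hi (fun x => x + H x) →
        nrm0 H ≤ ENNReal.ofReal L₄ →
        (if β ≤ 1 then nrm0 (fun x => fderiv ℝ H x)
          else holNorm (β - 1) (fun x => fderiv ℝ H x)) ≤ ENNReal.ofReal L₅ →
        ContDiff ℝ (ifl (β + μ) : ℕ) φ →
        holNorm (β + μ) (fun x => r1 x ^ (-θ) * φ x) ≠ ⊤ →
        holNorm β (fun x => r1 x ^ (-θ) * (φ (Hi x) - φ x)) ≤
          ENNReal.ofReal N * holNorm β (fun x => r1 x ^ (-θ) * φ x)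
              * (nrm0 H + (if β ≤ 1 then nrm0 (fun x => fderiv ℝ H x)
                  else holNorm (β - 1) (fun x => fderiv ℝ H x)))
            + ENNReal.ofReal N
              * ENNReal.ofReal
                  (Set.indicator (Set.Ioc (0 : ℝ) 1) (fun _ => (1 : ℝ)) (frc β + μ))
              * (∑' γ : {γ : Fin d → ℕ // (∑ i, γ i) = ifl β},
                  hsemi (frc β + μ) (mder γ.1 (fun x => r1 x ^ (-θ) * φ x)))
              * ENNReal.ofReal (L₄ ^ μ)
            + ENNReal.ofReal N
              * ENNReal.ofReal
                  (Set.indicator (Set.Ioc (1 : ℝ) 2) (fun _ => (1 : ℝ)) (frc β + μ))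
              * (∑' γ : {γ : Fin d → ℕ // (∑ i, γ i) = ifl β},
                  (hsemi (frc β + μ - 1)
                      (fun x => fderiv ℝ (mder γ.1 (fun y => r1 y ^ (-θ) * φ y)) x)
                    * ENNReal.ofReal (L₄ ^ μ)
                  + nrm0 (fun x => fderiv ℝ (mder γ.1 (fun y => r1 y ^ (-θ) * φ y)) x)
                    * nrm0 (fun x => fderiv ℝ H x))) := by
  obtain ⟨hμ0, hμ1⟩ := hμ
  have hα := frc_pos hβ
  have hα1 := frc_le_one β
  -- constants of the two top-order estimates
  set c₁ : ℝ := L₄ ^ frc β + 4 + Nκ * L₅ with hc₁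
  set c₂ : ℝ := (4 + 2 * L₄ ^ (1 - μ) + Nκ * L₅ + 1) * (1 + Nκ) with hc₂
  have hc₁0 : 0 ≤ c₁ := by positivity
  have hc₂0 : 0 ≤ c₂ := by positivity
  obtain ⟨C, hC, hmain⟩ := holNorm_weighted_comp_sub_le d (κ := Nκ) (c := c₁ + c₂) hβ hL₄ hL₅ hθ
    (by positivity)
  refine ⟨C + 1, by linarith, fun H Hi φ hH hB hl hr hH₀ hH₁ hφ hfin => ?_⟩
  have hCN : ENNReal.ofReal C ≤ ENNReal.ofReal (C + 1) := ENNReal.ofReal_le_ofReal (by linarith)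
  have hψ : ContDiff ℝ (ifl (β + μ)) (fun x => r1 x ^ (-θ) * φ x) := (contDiff_r1_rpow _).mul hφ
  have hP := holNorm_ne_top_of_add hβ hμ0 hμ1 hψ hfin
  have hHd := (nrm0_le_ite_holNorm (fun x => fderiv ℝ H x) β).trans hH₁
  have hHdt := ne_top_of_le_ne_top ENNReal.ofReal_ne_top hHd
  have hH₀t := ne_top_of_le_ne_top ENNReal.ofReal_ne_top hH₀
  have hF : ∀ x, ‖Hi x - x‖ ≤ (nrm0 H).toReal := fun x => by
    have e : Hi x - x = -H (Hi x) := by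
      rw [eq_neg_iff_add_eq_zero, sub_add_eq_add_sub, sub_eq_zero]
      exact hr x
    rw [e, norm_neg]
    exact norm_le_toReal_nrm0 hH₀t _
  have hH₀L : (nrm0 H).toReal ≤ L₄ := ENNReal.toReal_le_of_le_ofReal hL₄ hH₀
  have hHdL : (nrm0 fun x => fderiv ℝ H x).toReal ≤ L₅ := ENNReal.toReal_le_of_le_ofReal hL₅ hHd
  have hF' := norm_inverse_sub_sub_le (hH.of_le (by norm_cast; omega)) hB hl hr
    (norm_le_toReal_nrm0 hHdt)
  have hF'L : Nκ * (nrm0 fun x => fderiv ℝ H x).toReal ≤ Nκ * L₅ := by gcongr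
  specialize hmain H Hi φ (nrm0 H + if β ≤ 1 then nrm0 (fun x => fderiv ℝ H x)
    else holNorm (β - 1) (fun x => fderiv ℝ H x))
  set ψ : Euc d → ℝ := fun x => r1 x ^ (-θ) * φ x with hψdef
  set X := if β ≤ 1 then nrm0 (fun x => fderiv ℝ H x)
    else holNorm (β - 1) (fun x => fderiv ℝ H x) with hX
  have hXt := ne_top_of_le_ne_top ENNReal.ofReal_ne_top hH₁
  have hS0 : 0 ≤ (nrm0 H + X).toReal := ENNReal.toReal_nonneg
  have hP0 : 0 ≤ (holNorm β ψ).toReal := ENNReal.toReal_nonneg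
  have hHS : (nrm0 H).toReal ≤ (nrm0 H + X).toReal :=
    ENNReal.toReal_mono (ENNReal.add_ne_top.2 ⟨hH₀t, hXt⟩) le_self_add
  rcases le_or_gt (frc β + μ) 1 with hσ | hσ
  · have em := ifl_add_of_le hβ hμ0 hσ
    have ef : frc (β + μ) = frc β + μ := by
      simp only [frc, em]
      ring
    set T := ∑' γ : {γ : Fin d → ℕ // (∑ i, γ i) = ifl β}, hsemi (frc β + μ) (mder γ.1 ψ) with hT
    have hTt : T ≠ ⊤ := by
      refine ne_top_of_le_ne_top hfin ?_
      rw [hT, holNorm, em, ef]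
      exact le_add_self
    have h := hmain (T.toReal * L₄ ^ μ) hH hB hl hr hH₀ hH₁ rfl (em ▸ hψ) hP (by positivity) ?_
    · have e1 : ENNReal.ofReal ((Set.Ioc (0 : ℝ) 1).indicator (fun _ => (1 : ℝ)) (frc β + μ)) =
          1 := by
        rw [Set.indicator_of_mem (Set.mem_Ioc.2 ⟨by linarith, hσ⟩), ENNReal.ofReal_one]
      rw [e1, mul_one]
      refine h.trans (le_add_right (add_le_add (by gcongr) ?_))
      rw [ENNReal.ofReal_mul ENNReal.toReal_nonneg, ENNReal.ofReal_toReal hTt, ← mul_assoc]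
      gcongr
    · intro γ hγ
      have hle : hsemi (frc β + μ) (mder γ ψ) ≤ T :=
        ENNReal.le_tsum (f := fun γ : {γ : Fin d → ℕ // (∑ i, γ i) = ifl β} =>
          hsemi (frc β + μ) (mder γ.1 ψ)) ⟨γ, hγ⟩
      have hb := holderBdd_comp_sub_of_holder (f := mder γ ψ) (F := fun x => Hi x - x)
        (B := T.toReal)
        (L := L₄) (K := Nκ * L₅) hα hμ0 hσ ENNReal.toReal_nonneg hL₄ (by positivity)
        (fun x y => (norm_sub_le_toReal_hsemi (ne_top_of_le_ne_top hTt hle) x y).trans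
          (by gcongr)) (fun x => (hF x).trans hH₀L)
        (fun x y => (hF' x y).trans (by gcongr))
      simp only [add_sub_cancel] at hb
      refine hb.mono ?_
      have hTL : 0 ≤ T.toReal * L₄ ^ μ := by positivity
      calc c₁ * (T.toReal * L₄ ^ μ) ≤ (c₁ + c₂) * (T.toReal * L₄ ^ μ) := by gcongr; linarith
        _ ≤ _ := by
          gcongr
          linarith [mul_nonneg hP0 hS0]
  · have em := ifl_add_of_lt hμ1 hσ
    have ef : frc (β + μ) = frc β + μ - 1 := by
      simp only [frc, em]
      push_cast
      ring
    have hreg : ∀ γ : Fin d → ℕ, ∑ i, γ i = ifl β → ∃ A : ℝ,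
        HolderBdd (frc β + μ - 1) A 1 (mder γ ψ) := fun γ hγ =>
      ⟨_, ef ▸ holderBdd_mder_of_holNorm hψ hfin (by omega)⟩
    have hgt : ∀ γ : Fin d → ℕ, ∑ i, γ i = ifl β → nrm0 (fderiv ℝ (mder γ ψ)) ≠ ⊤ := fun γ hγ => by
      obtain ⟨A, hA⟩ := hreg γ hγ
      exact ne_top_of_le_ne_top ENNReal.ofReal_ne_top (nrm0_le_ofReal hA.2.2.1)
    have hgh : ∀ γ : Fin d → ℕ, ∑ i, γ i = ifl β →
        hsemi (frc β + μ - 1) (fderiv ℝ (mder γ ψ)) ≠ ⊤ := fun γ hγ => by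
      obtain ⟨A, hA⟩ := hreg γ hγ
      exact ne_top_of_le_ne_top ENNReal.ofReal_ne_top (hsemi_le_ofReal hA.nonneg hA.2.2.2)
    set u : {γ : Fin d → ℕ // (∑ i, γ i) = ifl β} → ℝ≥0∞ := fun γ =>
      hsemi (frc β + μ - 1) (fun x => fderiv ℝ (mder γ.1 ψ) x) * ENNReal.ofReal (L₄ ^ μ)
        + nrm0 (fun x => fderiv ℝ (mder γ.1 ψ) x) * nrm0 (fun x => fderiv ℝ H x) with hu
    have hut : ∀ γ, u γ ≠ ⊤ := fun γ => ENNReal.add_ne_top.2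
      ⟨ENNReal.mul_ne_top (hgh γ.1 γ.2) ENNReal.ofReal_ne_top,
        ENNReal.mul_ne_top (hgt γ.1 γ.2) hHdt⟩
    have hTt : ∑' γ, u γ ≠ ⊤ := by
      have := Fintype.ofFinite {γ : Fin d → ℕ // (∑ i, γ i) = ifl β}
      rw [tsum_fintype]
      exact ENNReal.sum_ne_top.2 fun γ _ => hut γ
    have h := hmain (∑' γ, u γ).toReal hH hB hl hr hH₀ hH₁ rfl
      (hψ.of_le (by rw [em]; norm_cast; omega)) hP ENNReal.toReal_nonneg ?_
    · have e1 : ENNReal.ofReal ((Set.Ioc (1 : ℝ) 2).indicator (fun _ => (1 : ℝ)) (frc β + μ)) =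
          1 := by
        rw [Set.indicator_of_mem (Set.mem_Ioc.2 ⟨hσ, by linarith⟩), ENNReal.ofReal_one]
      rw [e1, mul_one]
      rw [ENNReal.ofReal_toReal hTt] at h
      refine h.trans (add_le_add (le_add_right (by gcongr)) (by gcongr))
    · intro γ hγ
      obtain ⟨A', hA'⟩ := hreg γ hγ
      have hPγ := nrm0_le_holNorm (f := ψ) hγ.le
      have hb := holderBdd_comp_sub_of_fderiv_holder (f := mder γ ψ) (F := fun x => Hi x - x)
        (A := (holNorm β ψ).toReal) (L := L₄) (K := Nκ * L₅) hα hα1 hμ0 hμ1 hσ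
        ENNReal.toReal_nonneg hA'.2.1
        (fun x => (norm_le_toReal_nrm0 (ne_top_of_le_ne_top hP hPγ) x).trans
          (ENNReal.toReal_mono hP hPγ)) (norm_le_toReal_nrm0 (hgt γ hγ))
        (norm_sub_le_toReal_hsemi (hgh γ hγ)) hF hH₀L hF' (by positivity) hF'L
      simp only [add_sub_cancel] at hb
      refine hb.mono ?_
      have hle := ENNReal.toReal_mono hTt (ENNReal.le_tsum (f := u) ⟨γ, hγ⟩)
      rw [hu, ENNReal.toReal_add (ENNReal.mul_ne_top (hgh γ hγ) ENNReal.ofReal_ne_top)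
        (ENNReal.mul_ne_top (hgt γ hγ) hHdt), ENNReal.toReal_mul, ENNReal.toReal_mul,
        ENNReal.toReal_ofReal (by positivity)] at hle
      set a := (hsemi (frc β + μ - 1) (fderiv ℝ (mder γ ψ))).toReal * L₄ ^ μ with ha
      set b := (nrm0 (fderiv ℝ (mder γ ψ))).toReal * (nrm0 fun x => fderiv ℝ H x).toReal with hb'
      have ha0 : 0 ≤ a := by positivity
      have hb0 : 0 ≤ b := by positivity
      set t := (∑' γ, u γ).toReal with ht
      set p := (holNorm β ψ).toReal * (nrm0 H + X).toReal with hp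
      have hPH : (holNorm β ψ).toReal * (nrm0 H).toReal ≤ p := mul_le_mul_of_nonneg_left hHS hP0
      have hp0 : 0 ≤ p := by positivity
      have ht0 : 0 ≤ t := ENNReal.toReal_nonneg
      have hab : a + b ≤ t := hle
      have hNab := mul_le_mul_of_nonneg_left hab hNκ.le
      have hNp : 0 ≤ Nκ * p := by positivity
      have hNa : 0 ≤ Nκ * a := by positivity
      calc (4 + 2 * L₄ ^ (1 - μ) + Nκ * L₅ + 1) * ((holNorm β ψ).toReal * (nrm0 H).toReal + a +
            (nrm0 (fderiv ℝ (mder γ ψ))).toReal * (Nκ * (nrm0 fun x => fderiv ℝ H x).toReal))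
          ≤ (4 + 2 * L₄ ^ (1 - μ) + Nκ * L₅ + 1) * ((1 + Nκ) * (p + t)) := by
            refine mul_le_mul_of_nonneg_left ?_ (by positivity)
            rw [mul_left_comm, ← hb']
            linarith
        _ = c₂ * (p + t) := by rw [hc₂, mul_assoc]
        _ ≤ (c₁ + c₂) * (p + t) := by gcongr; linarith
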